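/- Consider SSBM(n,2,a/n,b/n) with constants a,b ≥ 0. If (a−b)² ≤ 2(a+b), then weak recovery is not solvable: for every ε > 0 and every sequence of estimators X̂_n mapping n-vertex graphs to {1,2}^n, P(A(X, X̂_n(G)) ≥ 1/2 + ε) does not tend to 1 as n → ∞. -/

import Mathlib

open Filter
open scoped Classical

abbrev VPair (n : ℕ) := {e : Fin n × Fin n // e.1 < e.2}

noncomputable def sbmMass {n k : ℕ} (p : Fin k → ℝ) (W : Matrix (Fin k) (Fin k) ℝ)
    (x : Fin n → Fin k) (g : VPair n → Bool) : ℝ :=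
  (∏ u, p (x u)) *
    ∏ e : VPair n,
      if g e then W (x e.1.1) (x e.1.2) else 1 - W (x e.1.1) (x e.1.2)

noncomputable def sbmProb {n k : ℕ} (p : Fin k → ℝ) (W : Matrix (Fin k) (Fin k) ℝ)
    (E : (Fin n → Fin k) → (VPair n → Bool) → Prop) : ℝ :=
  ∑ x : Fin n → Fin k, ∑ g : VPair n → Bool,
    if E x g then sbmMass p W x g else 0

noncomputable def agreement {n k : ℕ} (x y : Fin n → Fin k) : ℝ :=
  (Finset.univ : Finset (Equiv.Perm (Fin k))).sup' ⟨1, Finset.mem_univ 1⟩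
    fun π => ((Finset.univ.filter fun i : Fin n => x i = π (y i)).card : ℝ) / n


def ssbmW (k : ℕ) (A B : ℝ) : Matrix (Fin k) (Fin k) ℝ :=
  Matrix.of fun i j => if i = j then A else B

/-- Expectation of `F` under the product measure with coordinate weights `p i`. -/
noncomputable def EX {ι α : Type*} [Fintype ι] [Fintype α] (p : ι → α → ℝ)
    (F : (ι → α) → ℝ) : ℝ :=
  ∑ ω : ι → α, (∏ i, p i (ω i)) * F ω

/-- The configuration equal to `a` on `P` and to `b` off `P`. -/
noncomputable def mix {ι α : Type*} (P : ι → Prop) (a b : ι → α) : ι → α :=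
  fun i => if P i then a i else b i

section EX

variable {ι α β γ : Type*} [Fintype ι] [Fintype α] [Fintype β] [Fintype γ]

lemma EX_add (p : ι → α → ℝ) (F G : (ι → α) → ℝ) :
    EX p (fun ω => F ω + G ω) = EX p F + EX p G := by
  simp [EX, mul_add, Finset.sum_add_distrib]

lemma EX_const_mul (p : ι → α → ℝ) (c : ℝ) (F : (ι → α) → ℝ) :
    EX p (fun ω => c * F ω) = c * EX p F := by
  simp only [EX, Finset.mul_sum]
  exact Finset.sum_congr rfl fun _ _ => by ring

lemma EX_neg (p : ι → α → ℝ) (F : (ι → α) → ℝ) :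
    EX p (fun ω => - F ω) = - EX p F := by
  simp [EX]

lemma EX_sub (p : ι → α → ℝ) (F G : (ι → α) → ℝ) :
    EX p (fun ω => F ω - G ω) = EX p F - EX p G := by
  simp [EX, mul_sub, Finset.sum_sub_distrib]

lemma EX_sum {κ : Type*} (s : Finset κ) (p : ι → α → ℝ) (F : κ → (ι → α) → ℝ) :
    EX p (fun ω => ∑ k ∈ s, F k ω) = ∑ k ∈ s, EX p (F k) := by
  simp only [EX, Finset.mul_sum]
  exact Finset.sum_comm

lemma EX_mono {p : ι → α → ℝ} (hp : ∀ i a, 0 ≤ p i a) {F G : (ι → α) → ℝ}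
    (h : ∀ ω, F ω ≤ G ω) : EX p F ≤ EX p G :=
  Finset.sum_le_sum fun ω _ =>
    mul_le_mul_of_nonneg_left (h ω) (Finset.prod_nonneg fun i _ => hp i _)

lemma EX_nonneg {p : ι → α → ℝ} (hp : ∀ i a, 0 ≤ p i a) {F : (ι → α) → ℝ}
    (h : ∀ ω, 0 ≤ F ω) : 0 ≤ EX p F :=
  Finset.sum_nonneg fun ω _ => mul_nonneg (Finset.prod_nonneg fun i _ => hp i _) (h ω)

lemma EX_prod (p f : ι → α → ℝ) :
    EX p (fun ω => ∏ i, f i (ω i)) = ∏ i, ∑ a, p i a * f i a := by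
  rw [Finset.prod_univ_sum, Fintype.piFinset_univ]
  simp [EX, Finset.prod_mul_distrib]

lemma EX_const {p : ι → α → ℝ} (hp : ∀ i, ∑ a, p i a = 1) (c : ℝ) :
    EX p (fun _ => c) = c := by
  have := EX_prod p (fun _ _ => 1)
  simp [hp] at this
  have h2 := EX_const_mul p c (fun _ => 1)
  simp [this] at h2
  exact h2

lemma EX_abs_le {p : ι → α → ℝ} (hp : ∀ i a, 0 ≤ p i a) (F : (ι → α) → ℝ) :
    |EX p F| ≤ EX p (fun ω => |F ω|) := by
  refine (Finset.abs_sum_le_sum_abs _ _).trans (Finset.sum_le_sum fun ω _ => ?_)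
  rw [abs_mul, abs_of_nonneg (Finset.prod_nonneg fun i _ => hp i _)]

lemma EX_comm {κ : Type*} [Fintype κ] (p : ι → α → ℝ) (q : κ → β → ℝ)
    (F : (ι → α) → (κ → β) → ℝ) :
    EX p (fun a => EX q (fun b => F a b)) = EX q (fun b => EX p (fun a => F a b)) := by
  simp only [EX, Finset.mul_sum]
  rw [Finset.sum_comm]
  exact Finset.sum_congr rfl fun _ _ => Finset.sum_congr rfl fun _ _ => by ring

lemma EX_push (p : ι → α → ℝ) (q : ι → β → ℝ) (f : ι → α → β → γ) (F : (ι → γ) → ℝ) :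
    EX p (fun a => EX q (fun b => F (fun i => f i (a i) (b i)))) =
      EX (fun i c => ∑ a, ∑ b, if f i a b = c then p i a * q i b else 0) F := by
  have h : ∀ c : ι → γ, (∏ i, ∑ a, ∑ b, if f i a b = c i then p i a * q i b else 0) =
      ∑ a : ι → α, ∑ b : ι → β,
        if (fun i => f i (a i) (b i)) = c then (∏ i, p i (a i)) * ∏ i, q i (b i) else 0 := by
    intro c
    have h1 : ∀ i, (∑ a, ∑ b, if f i a b = c i then p i a * q i b else 0) =
        ∑ ab : α × β, if f i ab.1 ab.2 = c i then p i ab.1 * q i ab.2 else 0 := by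
      intro i
      rw [Fintype.sum_prod_type]
    simp only [h1]
    rw [Finset.prod_univ_sum, Fintype.piFinset_univ, ← Fintype.sum_prod_type'
      (f := fun (a : ι → α) (b : ι → β) => if (fun i => f i (a i) (b i)) = c then
        (∏ i, p i (a i)) * ∏ i, q i (b i) else 0)]
    refine Fintype.sum_equiv (Equiv.arrowProdEquivProdArrow ι (fun _ => α) (fun _ => β)) _ _ ?_
    intro ab
    rw [Finset.prod_ite_zero]
    simp [Equiv.arrowProdEquivProdArrow, funext_iff, Finset.prod_mul_distrib]
  simp only [EX]
  simp only [h, Finset.mul_sum, Finset.sum_mul]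
  rw [Finset.sum_comm' (t' := Finset.univ) (s' := fun _ => Finset.univ) (by simp)]
  symm
  rw [Finset.sum_comm]
  conv_rhs => rw [Finset.sum_comm]
  refine Finset.sum_congr rfl fun a _ => ?_
  rw [Finset.sum_comm]
  refine Finset.sum_congr rfl fun b _ => ?_
  simp only [ite_mul, zero_mul, Finset.sum_ite_eq, Finset.mem_univ, if_true]
  ring

lemma EX_mix {p q : ι → α → ℝ} (hp : ∀ i, ∑ a, p i a = 1) (hq : ∀ i, ∑ a, q i a = 1)
    (P : ι → Prop) (F : (ι → α) → ℝ) :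
    EX p (fun a => EX q (fun b => F (mix P a b))) = EX (mix P p q) F := by
  unfold mix
  rw [EX_push p q (fun i a b => if P i then a else b)]
  congr 1
  funext i c
  by_cases h : P i
  · simp [h, Finset.sum_ite_irrel, ← Finset.mul_sum, hq]
  · simp only [h, if_false]
    simp [← Finset.sum_mul, hp]

lemma EX_mix_self {p : ι → α → ℝ} (hp : ∀ i, ∑ a, p i a = 1) (P : ι → Prop)
    (F : (ι → α) → ℝ) :
    EX p (fun a => EX p (fun b => F (mix P a b))) = EX p F := by
  rw [EX_mix hp hp]
  congr 1
  funext i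
  simp [mix]

lemma EX_sq_le {p : ι → α → ℝ} (hp : ∀ i, ∑ a, p i a = 1) (hp0 : ∀ i a, 0 ≤ p i a)
    (F : (ι → α) → ℝ) : (EX p F) ^ 2 ≤ EX p (fun ω => F ω ^ 2) := by
  set m := EX p F with hm
  have h := EX_nonneg hp0 (F := fun ω => (F ω - m) ^ 2) (fun ω => sq_nonneg _)
  have h2 : EX p (fun ω => (F ω - m) ^ 2) =
      EX p (fun ω => F ω ^ 2) - 2 * m * EX p F + m ^ 2 := by
    rw [← EX_const_mul, ← EX_const hp (m ^ 2), ← EX_sub, ← EX_add]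
    congr 1
    funext ω
    ring
  rw [h2, ← hm] at h
  nlinarith

/-- Replacing the weights of the coordinates outside a stopping set does not change the
expectation of a function measurable with respect to that stopping set. -/
lemma sum_stopping {p q : ι → α → ℝ} (hp : ∀ i, ∑ a, p i a = 1) (hq : ∀ i, ∑ a, q i a = 1)
    (S : (ι → α) → Set ι) (hS : ∀ ω ω', (∀ i ∈ S ω, ω i = ω' i) → S ω' = S ω)
    (F : (ι → α) → ℝ) (hF : ∀ ω ω', (∀ i ∈ S ω, ω i = ω' i) → F ω' = F ω) :
    ∑ ω, (∏ i, mix (· ∈ S ω) p q i (ω i)) * F ω = EX p F := by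
  have key : ∀ T : Set ι, ∑ ω, (∏ i, mix (· ∈ T) p q i (ω i)) * (if S ω = T then F ω else 0) =
      ∑ ω, (∏ i, p i (ω i)) * (if S ω = T then F ω else 0) := by
    intro T
    change EX (mix (· ∈ T) p q) (fun ω => if S ω = T then F ω else 0) =
      EX p (fun ω => if S ω = T then F ω else 0)
    rw [← EX_mix hp hq]
    have : ∀ a b : ι → α, (if S (mix (· ∈ T) a b) = T then F (mix (· ∈ T) a b) else 0) =
        if S a = T then F a else 0 := by
      intro a b
      by_cases h : S a = T
      · have h1 : ∀ i ∈ S a, a i = mix (· ∈ T) a b i := by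
          intro i hi
          simp [mix, h ▸ hi]
        rw [hS a _ h1, hF a _ h1]
      · have : S (mix (· ∈ T) a b) ≠ T := by
          intro h'
          apply h
          rw [← h']
          apply hS
          intro i hi
          simp [mix, h' ▸ hi]
        simp [h, this]
    simp only [this, EX_const hq]
  have h1 : ∀ ω, (∏ i, mix (· ∈ S ω) p q i (ω i)) * F ω =
      ∑ T : Set ι, (∏ i, mix (· ∈ T) p q i (ω i)) * (if S ω = T then F ω else 0) := by
    intro ω
    simp [mul_ite]
  have h2 : ∀ ω, (∏ i, p i (ω i)) * F ω =
      ∑ T : Set ι, (∏ i, p i (ω i)) * (if S ω = T then F ω else 0) := by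
    intro ω
    simp [mul_ite]
  simp only [EX, h1, h2]
  rw [Finset.sum_comm]
  simp only [key]
  rw [Finset.sum_comm]

end EX

/-- The spin `±1` attached to a label. -/
def sg (i : Fin 2) : ℝ := if i = 0 then 1 else -1

lemma sg_mul_self (i : Fin 2) : sg i * sg i = 1 := by
  unfold sg; split_ifs <;> norm_num

lemma sg_sq (i : Fin 2) : sg i ^ 2 = 1 := by rw [sq, sg_mul_self]

lemma abs_sg (i : Fin 2) : |sg i| = 1 := by
  unfold sg; split_ifs <;> norm_num

/-- Product of the spins at the two ends of a pair. -/
def spin {n : ℕ} (e : VPair n) (x : Fin n → Fin 2) : ℝ := sg (x e.1.1) * sg (x e.1.2)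

lemma abs_spin {n : ℕ} (e : VPair n) (x : Fin n → Fin 2) : |spin e x| = 1 := by
  simp [spin, abs_mul, abs_sg]

/-- The fair-coin weights. -/
noncomputable def unif {ι : Type*} : ι → Fin 2 → ℝ := fun _ _ => 1 / 2

lemma unif_sum {ι : Type*} (i : ι) : ∑ a, unif i a = 1 := by simp [unif]

lemma unif_nonneg {ι : Type*} (i : ι) (a : Fin 2) : 0 ≤ unif i a := by simp [unif]

/-- Flip all labels in `C`. -/
noncomputable def flipOn {n : ℕ} (C : Set (Fin n)) (x : Fin n → Fin 2) : Fin n → Fin 2 :=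
  fun i => if i ∈ C then 1 - x i else x i

lemma sg_one_sub (i : Fin 2) : sg (1 - i) = - sg i := by
  fin_cases i <;> simp [sg]

lemma flipOn_flipOn {n : ℕ} (C : Set (Fin n)) (x : Fin n → Fin 2) : flipOn C (flipOn C x) = x := by
  funext i
  by_cases h : i ∈ C <;> simp [flipOn, h]

lemma sg_flip {n : ℕ} (C : Set (Fin n)) (x : Fin n → Fin 2) (i : Fin n) :
    sg (flipOn C x i) = (if i ∈ C then -1 else 1) * sg (x i) := by
  by_cases h : i ∈ C <;> simp [flipOn, h, sg_one_sub]

lemma EX_flip {n : ℕ} (C : Set (Fin n)) (f : (Fin n → Fin 2) → ℝ) :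
    EX unif (fun x => f (flipOn C x)) = EX unif f := by
  simp only [EX, unif]
  exact Finset.sum_equiv ⟨flipOn C, flipOn C, flipOn_flipOn C, flipOn_flipOn C⟩ (by simp)
    (fun x _ => by simp)

/-- The pair `e` has exactly one end in `C`. -/
def Crosses {n : ℕ} (C : Set (Fin n)) (e : VPair n) : Prop := ¬ (e.1.1 ∈ C ↔ e.1.2 ∈ C)

lemma spin_flip {n : ℕ} (C : Set (Fin n)) (x : Fin n → Fin 2) (e : VPair n) :
    spin e (flipOn C x) = (if Crosses C e then -1 else 1) * spin e x := by
  simp only [spin, sg_flip, Crosses]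
  by_cases h1 : e.1.1 ∈ C <;> by_cases h2 : e.1.2 ∈ C <;> simp [h1, h2]

/-- Ising weight with edge interactions `t`. -/
noncomputable def wt {n : ℕ} (t : VPair n → ℝ) (x : Fin n → Fin 2) : ℝ :=
  ∏ e, (1 + t e * spin e x)

/-- Average over the labels in `D`, the others being kept. -/
noncomputable def av {n : ℕ} (D : Finset (Fin n)) (f : (Fin n → Fin 2) → ℝ)
    (x : Fin n → Fin 2) : ℝ :=
  EX unif (fun y => f (mix (· ∈ D) y x))

lemma EX_av {n : ℕ} (D : Finset (Fin n)) (f : (Fin n → Fin 2) → ℝ) :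
    EX unif (av D f) = EX unif f := by
  unfold av
  rw [EX_comm, EX_mix_self unif_sum]

lemma av_mul_of_off {n : ℕ} (D : Finset (Fin n)) (f F : (Fin n → Fin 2) → ℝ)
    (hF : ∀ x y, (∀ i ∉ D, y i = x i) → F y = F x) (x : Fin n → Fin 2) :
    av D (fun y => F y * f y) x = F x * av D f x := by
  unfold av
  rw [← EX_const_mul]
  congr 1
  funext y
  beta_reduce
  rw [hF x (mix (· ∈ D) y x) fun i hi => by simp [mix, hi]]

lemma mix_flip {n : ℕ} (P : Fin n → Prop) (C : Set (Fin n)) (x y : Fin n → Fin 2) :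
    mix P (flipOn C y) (flipOn C x) = flipOn C (mix P y x) := by
  funext i
  by_cases h : P i <;> simp [mix, flipOn, h]

lemma av_flip {n : ℕ} (D : Finset (Fin n)) (C : Set (Fin n)) (f : (Fin n → Fin 2) → ℝ)
    (x : Fin n → Fin 2) : av D f (flipOn C x) = av D (fun y => f (flipOn C y)) x := by
  unfold av
  rw [← EX_flip C]
  simp only [mix_flip]

/-- Weighted average of the spin at `u` given the labels off `D`. -/
noncomputable def num {n : ℕ} (D : Finset (Fin n)) (u : Fin n) (t : VPair n → ℝ) :
    (Fin n → Fin 2) → ℝ := av D (fun y => wt t y * sg (y u))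

/-- Partition function given the labels off `D`. -/
noncomputable def den {n : ℕ} (D : Finset (Fin n)) (t : VPair n → ℝ) :
    (Fin n → Fin 2) → ℝ := av D (wt t)

/-- Second moment of the conditional magnetization at `u` given the labels off `D`. -/
noncomputable def mag {n : ℕ} (D : Finset (Fin n)) (u : Fin n) (t : VPair n → ℝ) : ℝ :=
  EX unif (fun x => num D u t x ^ 2 / den D t x)

lemma wt_update {n : ℕ} (t : VPair n → ℝ) (e : VPair n) (s : ℝ) (x : Fin n → Fin 2) :
    wt (Function.update t e s) x = wt (Function.update t e 0) x * (1 + s * spin e x) := by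
  unfold wt
  rw [← Finset.mul_prod_erase _ _ (Finset.mem_univ e),
    ← Finset.mul_prod_erase (a := e) (f := fun e' => 1 + Function.update t e 0 e' * spin e' x)
      _ (Finset.mem_univ e)]
  simp only [Function.update_self]
  rw [Finset.prod_congr rfl (g := fun e' => 1 + Function.update t e 0 e' * spin e' x)]
  · ring
  · intro e' he'
    simp [Function.update_of_ne (Finset.ne_of_mem_erase he')]

/-- `C` separates the ends of `e`, and no other interacting pair crosses it. -/
def IsCut {n : ℕ} (t : VPair n → ℝ) (e : VPair n) (C : Set (Fin n)) : Prop :=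
  Crosses C e ∧ ∀ e', e' ≠ e → t e' ≠ 0 → ¬ Crosses C e'

lemma wt_flip {n : ℕ} {t : VPair n → ℝ} {e : VPair n} {C : Set (Fin n)} (h : IsCut t e C)
    (s : ℝ) (x : Fin n → Fin 2) :
    wt (Function.update t e s) (flipOn C x) = wt (Function.update t e (-s)) x := by
  unfold wt
  refine Finset.prod_congr rfl fun e' _ => ?_
  rw [spin_flip]
  by_cases he : e' = e
  · subst he
    simp [h.1]
  · by_cases ht : t e' = 0
    · simp [Function.update_of_ne he, ht]
    · simp [Function.update_of_ne he, h.2 e' he ht]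

lemma wt_nonneg {n : ℕ} {t : VPair n → ℝ} (ht : ∀ e, |t e| ≤ 1) (x : Fin n → Fin 2) :
    0 ≤ wt t x := by
  refine Finset.prod_nonneg fun e _ => ?_
  have : |t e * spin e x| ≤ 1 := by rw [abs_mul, abs_spin, mul_one]; exact ht e
  linarith [neg_abs_le (t e * spin e x)]

lemma den_nonneg {n : ℕ} (D : Finset (Fin n)) {t : VPair n → ℝ} (ht : ∀ e, |t e| ≤ 1)
    (x : Fin n → Fin 2) : 0 ≤ den D t x :=
  EX_nonneg unif_nonneg fun _ => wt_nonneg ht _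

lemma abs_num_le {n : ℕ} (D : Finset (Fin n)) (u : Fin n) {t : VPair n → ℝ}
    (ht : ∀ e, |t e| ≤ 1) (x : Fin n → Fin 2) : |num D u t x| ≤ den D t x := by
  refine (EX_abs_le unif_nonneg _).trans (EX_mono unif_nonneg fun y => ?_)
  rw [abs_mul, abs_sg, mul_one, abs_of_nonneg (wt_nonneg ht _)]

lemma mag_flip {n : ℕ} (D : Finset (Fin n)) (u : Fin n) {t : VPair n → ℝ} {e : VPair n}
    {C : Set (Fin n)} (h : IsCut t e C) (s : ℝ) :
    mag D u (Function.update t e (-s)) = mag D u (Function.update t e s) := by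
  unfold mag
  rw [← EX_flip C (fun x => num D u (Function.update t e s) x ^ 2 / _)]
  congr 1
  funext x
  have h1 : den D (Function.update t e s) (flipOn C x) = den D (Function.update t e (-s)) x := by
    unfold den
    rw [av_flip]
    simp only [wt_flip h]
  have h2 : num D u (Function.update t e s) (flipOn C x) =
      (if u ∈ C then -1 else 1) * num D u (Function.update t e (-s)) x := by
    unfold num
    rw [av_flip]
    simp only [wt_flip h, sg_flip]
    unfold av
    rw [← EX_const_mul]
    congr 1
    funext y
    ring
  rw [h1, h2, mul_pow]
  split_ifs <;> simp

lemma symm_frac_le {A B Z Y s : ℝ} (hs : |s| ≤ 1) (h1 : |A + B| ≤ Z + Y) (h2 : |A - B| ≤ Z - Y) :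
    (A + s * B) ^ 2 / (Z + s * Y) + (A - s * B) ^ 2 / (Z - s * Y) ≤
      (1 - s ^ 2) * (2 * (A ^ 2 / Z)) +
        s ^ 2 * ((A + B) ^ 2 / (Z + Y) + (A - B) ^ 2 / (Z - Y)) := by
  have hs2 : s ^ 2 ≤ 1 := by rw [← sq_abs]; nlinarith [abs_nonneg s]
  have hp : 0 ≤ Z + Y := (abs_nonneg _).trans h1
  have hm : 0 ≤ Z - Y := (abs_nonneg _).trans h2
  rcases eq_or_lt_of_le (show s ^ 2 ≤ 1 from hs2) with hs1 | hs1
  · have : s = 1 ∨ s = -1 := by simpa using hs1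
    rcases this with rfl | rfl
    · simp
    · simp only [neg_mul, one_mul, sub_neg_eq_add]
      norm_num
      rw [← sub_eq_add_neg, ← sub_eq_add_neg, add_comm]
  rcases eq_or_lt_of_le hp with hp0 | hp0
  · have hA : A + B = 0 := abs_nonpos_iff.mp (hp0 ▸ h1)
    have hB : B = -A := by linarith
    have hY : Y = -Z := by linarith
    subst hB hY
    rcases eq_or_ne Z 0 with rfl | hZ
    · simp
    · have e1 : Z + s * -Z ≠ 0 := by
        have : Z + s * -Z = Z * (1 - s) := by ring
        rw [this]; refine mul_ne_zero hZ ?_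
        intro h; apply hs1.ne; nlinarith
      have e2 : Z - s * -Z ≠ 0 := by
        have : Z - s * -Z = Z * (1 + s) := by ring
        rw [this]; refine mul_ne_zero hZ ?_
        intro h; apply hs1.ne; nlinarith
      have e3 : (A + s * -A) ^ 2 / (Z + s * -Z) = (1 - s) * (A ^ 2 / Z) := by
        field_simp; ring
      have e4 : (A - s * -A) ^ 2 / (Z - s * -Z) = (1 + s) * (A ^ 2 / Z) := by
        field_simp; ring
      have e5 : (A - -A) ^ 2 / (Z - -Z) = 2 * (A ^ 2 / Z) := by
        field_simp; ring
      rw [e3, e4, e5]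
      simp
      apply le_of_eq; ring
  rcases eq_or_lt_of_le hm with hm0 | hm0
  · have hA : A - B = 0 := abs_nonpos_iff.mp (hm0 ▸ h2)
    have hB : B = A := by linarith
    have hY : Y = Z := by linarith
    subst hB hY
    rcases eq_or_ne Y 0 with rfl | hZ
    · simp
    · have e1 : Y + s * Y ≠ 0 := by
        have : Y + s * Y = Y * (1 + s) := by ring
        rw [this]; refine mul_ne_zero hZ ?_
        intro h; apply hs1.ne; nlinarith
      have e2 : Y - s * Y ≠ 0 := by
        have : Y - s * Y = Y * (1 - s) := by ring
        rw [this]; refine mul_ne_zero hZ ?_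
        intro h; apply hs1.ne; nlinarith
      have e3 : (B + s * B) ^ 2 / (Y + s * Y) = (1 + s) * (B ^ 2 / Y) := by
        field_simp
      have e4 : (B - s * B) ^ 2 / (Y - s * Y) = (1 - s) * (B ^ 2 / Y) := by
        field_simp
      have e5 : (B + B) ^ 2 / (Y + Y) = 2 * (B ^ 2 / Y) := by
        field_simp; ring
      rw [e3, e4, e5]
      simp
      apply le_of_eq; ring
  have hZ : 0 < Z := by linarith
  have hYZ : Y ^ 2 < Z ^ 2 := by nlinarith
  have hsY : 0 < Z ^ 2 - s ^ 2 * Y ^ 2 := by nlinarith [sq_nonneg Y]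
  have hsp : Z + s * Y ≠ 0 := by
    intro h; apply hsY.ne'; linear_combination (Z - s * Y) * h
  have hsm : Z - s * Y ≠ 0 := by
    intro h; apply hsY.ne'; linear_combination (Z + s * Y) * h
  have e1 : (A + s * B) ^ 2 / (Z + s * Y) + (A - s * B) ^ 2 / (Z - s * Y) =
      2 * (A ^ 2 / Z) + s ^ 2 * (2 * (Z * B - A * Y) ^ 2 / Z / (Z ^ 2 - s ^ 2 * Y ^ 2)) := by
    have : Z ^ 2 - s ^ 2 * Y ^ 2 = (Z + s * Y) * (Z - s * Y) := by ring
    rw [this]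
    field_simp
    ring
  have e2 : (A + B) ^ 2 / (Z + Y) + (A - B) ^ 2 / (Z - Y) =
      2 * (A ^ 2 / Z) + 2 * (Z * B - A * Y) ^ 2 / Z / (Z ^ 2 - Y ^ 2) := by
    have : Z ^ 2 - Y ^ 2 = (Z + Y) * (Z - Y) := by ring
    rw [this]
    have := hp0.ne'
    have := hm0.ne'
    field_simp
    ring
  rw [e1, e2]
  have e3 : 2 * (Z * B - A * Y) ^ 2 / Z / (Z ^ 2 - s ^ 2 * Y ^ 2) ≤
      2 * (Z * B - A * Y) ^ 2 / Z / (Z ^ 2 - Y ^ 2) := by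
    apply div_le_div_of_nonneg_left (by positivity) (by linarith)
    nlinarith [sq_nonneg Y]
  nlinarith [sq_nonneg s]

lemma mag_update_le {n : ℕ} (D : Finset (Fin n)) (u : Fin n) {t : VPair n → ℝ} {e : VPair n}
    {C : Set (Fin n)} (h : IsCut t e C) (ht : ∀ e, |t e| ≤ 1) :
    mag D u t ≤ (1 - t e ^ 2) * mag D u (Function.update t e 0) +
      t e ^ 2 * mag D u (Function.update t e 1) := by
  have hupd : ∀ s : ℝ, |s| ≤ 1 → ∀ e', |Function.update t e s e'| ≤ 1 := by
    intro s hs e'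
    by_cases he : e' = e
    · subst he; simpa using hs
    · simpa [Function.update_of_ne he] using ht e'
  set B : (Fin n → Fin 2) → ℝ :=
    av D (fun y => wt (Function.update t e 0) y * spin e y * sg (y u)) with hB
  set Y : (Fin n → Fin 2) → ℝ :=
    av D (fun y => wt (Function.update t e 0) y * spin e y) with hY
  have hn : ∀ s x, num D u (Function.update t e s) x =
      num D u (Function.update t e 0) x + s * B x := by
    intro s x
    simp only [num, hB, av]
    rw [← EX_const_mul, ← EX_add]
    congr 1
    funext y
    rw [wt_update]
    ring
  have hd : ∀ s x, den D (Function.update t e s) x =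
      den D (Function.update t e 0) x + s * Y x := by
    intro s x
    simp only [den, hY, av]
    rw [← EX_const_mul, ← EX_add]
    congr 1
    funext y
    rw [wt_update]
    ring
  have hself : Function.update t e (t e) = t := Function.update_eq_self _ _
  have key : mag D u (Function.update t e (t e)) + mag D u (Function.update t e (-t e)) ≤
      (1 - t e ^ 2) * (2 * mag D u (Function.update t e 0)) +
        t e ^ 2 * (mag D u (Function.update t e 1) + mag D u (Function.update t e (-1))) := by
    unfold mag
    rw [← EX_add, ← EX_add, ← EX_const_mul, ← EX_const_mul, ← EX_const_mul, ← EX_add]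
    refine EX_mono unif_nonneg fun x => ?_
    have h1 := abs_num_le D u (hupd 1 (by simp)) x
    have h2 := abs_num_le D u (hupd (-1) (by simp)) x
    rw [hn 1, hd 1] at h1 ⊢
    rw [hn (-1), hd (-1)] at h2 ⊢
    rw [hn (t e), hd (t e), hn (-t e), hd (-t e)]
    have := symm_frac_le (A := num D u (Function.update t e 0) x) (B := B x)
      (Z := den D (Function.update t e 0) x) (Y := Y x) (s := t e) (ht e)
      (by simpa using h1) (by simpa [sub_eq_add_neg] using h2)
    simpa [sub_eq_add_neg] using this
  rw [mag_flip D u h, mag_flip D u h, hself] at key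
  linarith

lemma EX_wt_eq_one {n : ℕ} (t : VPair n → ℝ) (h : ∀ e, t e ≠ 0 → ∃ C, IsCut t e C) :
    EX unif (wt t) = 1 := by
  have key : ∀ A : Finset (VPair n), EX unif (wt t) =
      EX unif (wt (fun e => if e ∈ A then 0 else t e)) := by
    intro A
    induction A using Finset.induction_on with
    | empty => simp
    | insert e A he ih =>
      rw [ih]
      set t' : VPair n → ℝ := fun e => if e ∈ A then 0 else t e with ht'
      have hu : (fun e' => if e' ∈ insert e A then 0 else t e') = Function.update t' e 0 := by
        funext e'
        by_cases h1 : e' = e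
        · subst h1; simp
        · simp [h1, ht']
      rw [hu]
      have hte : t' e = t e := by simp [ht', he]
      by_cases h0 : t e = 0
      · rw [show Function.update t' e 0 = t' from by rw [← h0, ← hte, Function.update_eq_self]]
      obtain ⟨C, hC⟩ := h e h0
      have hC' : IsCut t' e C := by
        refine ⟨hC.1, fun e' h1 h2 => hC.2 e' h1 ?_⟩
        simp only [ht'] at h2
        split_ifs at h2 <;> simp_all
      have h1 : EX unif (wt (Function.update t' e (t' e))) =
          EX unif (wt (Function.update t' e (-t' e))) := by
        rw [← EX_flip C]
        simp only [wt_flip hC']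
      have h2 : EX unif (wt (Function.update t' e (t' e))) +
          EX unif (wt (Function.update t' e (-t' e))) = 2 * EX unif (wt (Function.update t' e 0)) := by
        rw [← EX_add, ← EX_const_mul]
        congr 1
        funext x
        rw [wt_update, wt_update _ _ (-t' e)]
        ring
      rw [Function.update_eq_self] at h1 h2
      linarith
  rw [key Finset.univ]
  have : wt (fun e : VPair n => if e ∈ Finset.univ then (0 : ℝ) else t e) = fun _ => 1 := by
    funext x; simp [wt]
  rw [this, EX_const unif_sum]

lemma mag_le_one {n : ℕ} (D : Finset (Fin n)) (u : Fin n) {t : VPair n → ℝ}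
    (ht : ∀ e, |t e| ≤ 1) (h : ∀ e, t e ≠ 0 → ∃ C, IsCut t e C) : mag D u t ≤ 1 := by
  rw [← EX_wt_eq_one t h, ← EX_av D]
  refine EX_mono unif_nonneg fun x => ?_
  change _ ≤ den D t x
  have h1 := abs_num_le D u ht x
  refine div_le_of_le_mul₀ (den_nonneg D ht x) (den_nonneg D ht x) ?_
  rw [← sq_abs, sq]
  exact mul_le_mul h1 h1 (abs_nonneg _) (den_nonneg D ht x)

lemma mag_eq_zero {n : ℕ} (D : Finset (Fin n)) (u : Fin n) (t : VPair n → ℝ)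
    (C : Set (Fin n)) (hu : u ∈ C) (hCD : ∀ i ∈ C, i ∈ D)
    (hC : ∀ e, t e ≠ 0 → ¬ Crosses C e) : mag D u t = 0 := by
  have hw : ∀ y, wt t (flipOn C y) = wt t y := by
    intro y
    refine Finset.prod_congr rfl fun e _ => ?_
    rw [spin_flip]
    by_cases ht : t e = 0
    · simp [ht]
    · simp [hC e ht]
  have hm : ∀ x y, mix (· ∈ D) (flipOn C y) x = flipOn C (mix (· ∈ D) y x) := by
    intro x y
    funext i
    by_cases hi : i ∈ D
    · simp [mix, flipOn, hi]
    · have : i ∉ C := fun h => hi (hCD i h)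
      simp [mix, flipOn, hi, this]
  have h0 : ∀ x, num D u t x = 0 := by
    intro x
    have : num D u t x = - num D u t x := by
      conv_lhs => unfold num av
      rw [← EX_flip C]
      simp only [hm, hw, sg_flip, hu, if_true]
      unfold num av
      rw [← EX_neg]
      congr 1
      funext y
      ring
    linarith
  simp [mag, h0, EX]

/-- Bernoulli weights. -/
noncomputable def bw {ι : Type*} (p : ι → ℝ) : ι → Bool → ℝ :=
  fun i b => if b then p i else 1 - p i

lemma bw_sum {ι : Type*} (p : ι → ℝ) (i : ι) : ∑ b, bw p i b = 1 := by simp [bw]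

lemma bw_nonneg {ι : Type*} {p : ι → ℝ} (h0 : ∀ i, 0 ≤ p i) (h1 : ∀ i, p i ≤ 1) (i : ι)
    (b : Bool) : 0 ≤ bw p i b := by
  cases b <;> simp [bw, h0, h1]

section Bernoulli

variable {ι : Type*} [Fintype ι]

lemma EX_coord {α : Type*} [Fintype α] {p : ι → α → ℝ} (hp : ∀ i, ∑ a, p i a = 1) (e : ι)
    (f : α → ℝ) : EX p (fun ω => f (ω e)) = ∑ a, p e a * f a := by
  have h := EX_prod p (fun i a => if i = e then f a else 1)
  have h1 : ∀ ω : ι → α, (∏ i, if i = e then f (ω i) else 1) = f (ω e) := by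
    intro ω
    rw [Finset.prod_eq_single e] <;> simp_all
  simp only [h1] at h
  rw [h, Finset.prod_eq_single e]
  · simp
  · intro i _ hi
    simp [hi, hp]
  · simp

lemma EX_resample [DecidableEq ι] (p : ι → ℝ) (e : ι) (K : (ι → Bool) → ℝ) :
    EX (bw p) K = EX (bw p) (fun ω => (1 - p e) * K (Function.update ω e false) +
      p e * K (Function.update ω e true)) := by
  rw [← EX_mix_self (bw_sum p) (· = e), EX_comm]
  congr 1
  funext b
  have h : ∀ a, mix (· = e) a b = Function.update b e (a e) := by
    intro a
    funext i
    by_cases hi : i = e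
    · subst hi; simp [mix]
    · simp [mix, hi]
  simp only [h]
  rw [EX_coord (bw_sum p) e (fun c => K (Function.update b e c))]
  simp [bw]
  ring

lemma EX_and (p q : ι → ℝ) (F : (ι → Bool) → ℝ) :
    EX (bw p) (fun g => EX (bw q) (fun ω => F (fun e => g e && ω e))) =
      EX (bw (fun e => p e * q e)) F := by
  rw [EX_push _ _ (fun _ a b => a && b)]
  congr 1
  funext i c
  cases c <;> simp [bw]
  ring

end Bernoulli

/-- Every open pair is separated by a cut that no other open pair crosses. -/
def Forest {n : ℕ} (h : VPair n → Bool) : Prop :=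
  ∀ e, h e = true → ∃ C, Crosses C e ∧ ∀ e', e' ≠ e → h e' = true → ¬ Crosses C e'

lemma Forest.isCut {n : ℕ} {h : VPair n → Bool} (hF : Forest h) (t : VPair n → ℝ)
    (ht : ∀ e, t e ≠ 0 → h e = true) (e : VPair n) (he : h e = true) : ∃ C, IsCut t e C := by
  obtain ⟨C, h1, h2⟩ := hF e he
  exact ⟨C, h1, fun e' h3 h4 => h2 e' h3 (ht e' h4)⟩

/-- Percolation domination: on a forest, replacing each interaction `θ` by an erasure of
parameter `θ ^ 2` increases the second moment of the magnetization. -/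
lemma mag_le_percolation {n : ℕ} (D : Finset (Fin n)) (u : Fin n) {h : VPair n → Bool}
    (hF : Forest h) {θ : ℝ} (hθ : |θ| ≤ 1) :
    mag D u (fun e => if h e then θ else 0) ≤
      EX (bw fun _ : VPair n => θ ^ 2)
        (fun ω => mag D u (fun e => if h e && ω e then 1 else 0)) := by
  have hθ2 : θ ^ 2 ≤ 1 := by rw [← sq_abs]; nlinarith [abs_nonneg θ]
  have hb := bw_nonneg (p := fun _ : VPair n => θ ^ 2) (fun _ => sq_nonneg θ) (fun _ => hθ2)
  set tt : Finset (VPair n) → (VPair n → Bool) → VPair n → ℝ := fun A ω e =>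
    if e ∈ A then (if h e && ω e then 1 else 0) else (if h e then θ else 0) with htt
  have key : ∀ A : Finset (VPair n), mag D u (fun e => if h e then θ else 0) ≤
      EX (bw fun _ : VPair n => θ ^ 2) (fun ω => mag D u (tt A ω)) := by
    intro A
    induction A using Finset.induction_on with
    | empty => simp [htt, EX_const (bw_sum _)]
    | insert e A he ih =>
      refine ih.trans ?_
      rw [EX_resample _ e (fun ω => mag D u (tt (insert e A) ω))]
      refine EX_mono hb fun ω => ?_
      have hne : ∀ b, tt (insert e A) (Function.update ω e b) =
          Function.update (tt A ω) e (if h e && b then 1 else 0) := by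
        intro b
        funext e'
        by_cases h1 : e' = e
        · subst h1; simp [htt]
        · simp [htt, h1]
      have hte : tt A ω e = if h e then θ else 0 := by simp [htt, he]
      rw [hne, hne]
      by_cases h0 : h e = true
      · have hsupp : ∀ e', tt A ω e' ≠ 0 → h e' = true := by
          intro e' h1
          by_contra h2
          simp [htt, h2] at h1
        obtain ⟨C, hC⟩ := hF.isCut (tt A ω) hsupp e h0
        have hle : ∀ e', |tt A ω e'| ≤ 1 := by
          intro e'
          simp only [htt]
          split_ifs <;> simp [hθ]
        have := mag_update_le D u hC hle
        simpa [h0, hte] using this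
      · have : Function.update (tt A ω) e 0 = tt A ω := by
          rw [Function.update_eq_self_iff, hte]; simp [h0]
        simp [h0, this]
        linarith
  simpa [htt] using key Finset.univ

/-- The pair with ends `u` and `v`. -/
def ed {n : ℕ} (u v : Fin n) (h : u ≠ v) : VPair n :=
  if h' : u < v then ⟨(u, v), h'⟩ else ⟨(v, u), lt_of_le_of_ne (not_lt.mp h') h.symm⟩

lemma ed_symm {n : ℕ} (u v : Fin n) (h : u ≠ v) : ed u v h = ed v u h.symm := by
  unfold ed
  rcases lt_or_gt_of_ne h with h1 | h1
  · simp [h1, h1.not_gt]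
  · simp [h1, h1.not_gt]

lemma ed_fst_snd {n : ℕ} (e : VPair n) : ed e.1.1 e.1.2 e.2.ne = e := by
  simp [ed, e.2]

/-- The pair meets `D`. -/
def Touch {n : ℕ} (D : Set (Fin n)) (e : VPair n) : Prop := e.1.1 ∈ D ∨ e.1.2 ∈ D

lemma touch_ed {n : ℕ} (D : Set (Fin n)) (u v : Fin n) (h : u ≠ v) :
    Touch D (ed u v h) ↔ u ∈ D ∨ v ∈ D := by
  unfold ed Touch
  split_ifs
  · simp
  · simp [or_comm]

/-- The graph of open pairs. -/
def Gr {n : ℕ} (g : VPair n → Bool) : SimpleGraph (Fin n) where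
  Adj u v := ∃ h : u ≠ v, g (ed u v h) = true
  symm := ⟨fun u v ⟨h, hg⟩ => ⟨h.symm, by rwa [ed_symm] at hg⟩⟩
  loopless := ⟨fun _ ⟨h, _⟩ => h rfl⟩

lemma Gr_mono {n : ℕ} {g g' : VPair n → Bool} (h : ∀ e, g e = true → g' e = true) :
    Gr g ≤ Gr g' := fun _ _ ⟨hne, hg⟩ => ⟨hne, h _ hg⟩

lemma Gr_adj {n : ℕ} {g : VPair n → Bool} {e : VPair n} (h : g e = true) :
    (Gr g).Adj e.1.1 e.1.2 := ⟨e.2.ne, by rwa [ed_fst_snd]⟩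

/-- The ball of radius `i` around `u`. -/
noncomputable def ball {n : ℕ} (g : VPair n → Bool) (u : Fin n) : ℕ → Finset (Fin n)
  | 0 => {u}
  | i + 1 => Finset.univ.filter fun z => z ∈ ball g u i ∨ ∃ w ∈ ball g u i, (Gr g).Adj w z

lemma ball_subset_succ {n : ℕ} (g : VPair n → Bool) (u : Fin n) (i : ℕ) :
    ball g u i ⊆ ball g u (i + 1) := fun z hz => by simp [ball, hz]

lemma ball_mono {n : ℕ} (g : VPair n → Bool) (u : Fin n) : Monotone (ball g u) :=
  monotone_nat_of_le_succ (ball_subset_succ g u)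

lemma mem_ball_self {n : ℕ} (g : VPair n → Bool) (u : Fin n) (i : ℕ) : u ∈ ball g u i :=
  ball_mono g u (Nat.zero_le i) (by simp [ball])

lemma mem_ball_of_adj {n : ℕ} {g : VPair n → Bool} {u w z : Fin n} {i : ℕ}
    (hw : w ∈ ball g u i) (h : (Gr g).Adj w z) : z ∈ ball g u (i + 1) := by
  simp only [ball, Finset.mem_filter, Finset.mem_univ, true_and]
  exact Or.inr ⟨w, hw, h⟩

lemma mem_ball_of_walk {n : ℕ} {g : VPair n → Bool} {u w z : Fin n} (p : (Gr g).Walk w z) :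
    ∀ {i : ℕ}, w ∈ ball g u i → z ∈ ball g u (i + p.length) := by
  induction p with
  | nil => intro i h; simpa using h
  | cons h p ih =>
    intro i hw
    have := ih (mem_ball_of_adj hw h)
    rw [SimpleGraph.Walk.length_cons]
    convert this using 2
    omega

lemma exists_walk_of_mem_ball {n : ℕ} {g : VPair n → Bool} {u : Fin n} :
    ∀ {i : ℕ} {z : Fin n}, z ∈ ball g u i → ∃ p : (Gr g).Walk u z, p.length ≤ i := by
  intro i
  induction i with
  | zero =>
    intro z hz
    simp only [ball, Finset.mem_singleton] at hz
    subst hz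
    exact ⟨.nil, by simp⟩
  | succ i ih =>
    intro z hz
    simp only [ball, Finset.mem_filter, Finset.mem_univ, true_and] at hz
    rcases hz with hz | ⟨w, hw, h⟩
    · obtain ⟨p, hp⟩ := ih hz
      exact ⟨p, by omega⟩
    · obtain ⟨p, hp⟩ := ih hw
      exact ⟨p.concat h, by simp [hp]⟩

/-- The ball of radius `r + 1` is determined by the pairs meeting the ball of radius `r`. -/
lemma ball_congr {n : ℕ} {g g' : VPair n → Bool} {u : Fin n} {r : ℕ}
    (h : ∀ e, Touch (ball g u r : Set (Fin n)) e → g e = g' e) :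
    ∀ i ≤ r + 1, ball g' u i = ball g u i := by
  intro i
  induction i with
  | zero => intro _; simp [ball]
  | succ i ih =>
    intro hi
    ext z
    simp only [ball, Finset.mem_filter, Finset.mem_univ, true_and]
    rw [ih (by omega)]
    refine or_congr Iff.rfl (exists_congr fun w => and_congr_right fun hw => ?_)
    have hw' : w ∈ ball g u r := ball_mono g u (by omega) hw
    constructor
    · rintro ⟨hne, hg⟩
      exact ⟨hne, by rw [h _ ((touch_ed _ _ _ _).mpr (Or.inl (by simpa using hw')))]; exact hg⟩
    · rintro ⟨hne, hg⟩
      exact ⟨hne, by rw [← h _ ((touch_ed _ _ _ _).mpr (Or.inl (by simpa using hw')))]; exact hg⟩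

/-- There is a self-avoiding walk of length `r` from `w` avoiding `U`. -/
def SAW {n : ℕ} (g : VPair n → Bool) : ℕ → Fin n → Set (Fin n) → Prop
  | 0, _, _ => True
  | r + 1, w, U => ∃ z, z ∉ insert w U ∧ (Gr g).Adj w z ∧ SAW g r z (insert w U)

lemma SAW_of_isPath {n : ℕ} {g : VPair n → Bool} {w z : Fin n} (p : (Gr g).Walk w z) :
    ∀ {r : ℕ} {U : Set (Fin n)}, p.IsPath → r ≤ p.length → (∀ v ∈ p.support, v ∉ U) →
      SAW g r w U := by
  induction p with
  | nil =>
    intro r U _ hr _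
    obtain rfl : r = 0 := by simpa using hr
    trivial
  | @cons x y z h p ih =>
    intro r U hp hr hU
    cases r with
    | zero => trivial
    | succ r =>
      rw [SimpleGraph.Walk.cons_isPath_iff] at hp
      have hav : ∀ v ∈ p.support, v ∉ insert x U := by
        intro v hv hmem
        rcases hmem with rfl | hmem
        · exact hp.2 hv
        · exact hU v (by simp [hv]) hmem
      exact ⟨_, hav _ p.start_mem_support, h,
        ih hp.1 (by simpa using hr) hav⟩

/-- Open pairs meeting `D`. -/
noncomputable def rest {n : ℕ} (D : Finset (Fin n)) (g : VPair n → Bool) : VPair n → Bool :=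
  fun e => g e && decide (Touch (D : Set (Fin n)) e)

lemma mag_open_le {n : ℕ} (g ω : VPair n → Bool) (u : Fin n) (r : ℕ)
    (hF : Forest (rest (ball g u r) g)) :
    mag (ball g u r) u (fun e => if rest (ball g u r) g e && ω e then 1 else 0) ≤
      if SAW (fun e => g e && ω e) (r + 1) u ∅ then 1 else 0 := by
  set D := ball g u r
  set η : VPair n → Bool := fun e => rest D g e && ω e with hη
  have hη1 : ∀ e, η e = true → rest D g e = true := by
    intro e he
    simp [hη] at he
    exact he.1
  have hη2 : ∀ e, η e = true → (g e && ω e) = true := by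
    intro e he
    simp [hη, rest] at he
    simp [he]
  change mag D u (fun e => if η e then 1 else 0) ≤ _
  by_cases hr : ∃ z, z ∉ D ∧ (Gr η).Reachable u z
  · obtain ⟨z, hz, ⟨p⟩⟩ := hr
    have hS : SAW (fun e => g e && ω e) (r + 1) u ∅ := by
      set q := (p.mapLe (Gr_mono hη2)).toPath with hq
      refine SAW_of_isPath q.1 q.2 ?_ (by simp)
      by_contra hlt
      have hg : Gr (fun e => g e && ω e) ≤ Gr g := Gr_mono fun e he => by simp at he; exact he.1
      have := mem_ball_of_walk (q.1.mapLe hg) (mem_ball_self g u 0)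
      rw [SimpleGraph.Walk.length_map] at this
      exact hz (ball_mono g u (by omega) this)
    rw [if_pos hS]
    refine mag_le_one D u (fun e => by split_ifs <;> simp) (fun e he => ?_)
    have he' : η e = true := by by_contra h; simp [h] at he
    refine hF.isCut _ (fun e' h' => hη1 e' ?_) e (hη1 e he')
    by_contra h
    simp [h] at h'
  · have h0 : mag D u (fun e => if η e then 1 else 0) = 0 := by
      refine mag_eq_zero D u _ {z | (Gr η).Reachable u z} (SimpleGraph.Reachable.refl u) ?_ ?_
      · intro i hi
        by_contra h
        exact hr ⟨i, h, hi⟩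
      · intro e he hc
        have he' : η e = true := by by_contra h; simp [h] at he
        have hadj := (Gr_adj he').reachable
        exact hc ⟨fun h1 => h1.trans hadj, fun h1 => h1.trans hadj.symm⟩
    rw [h0]
    split_ifs <;> norm_num

lemma SAW_congr {n : ℕ} {g g' : VPair n → Bool} {r : ℕ} :
    ∀ {w : Fin n} {U : Set (Fin n)}, w ∉ U → (∀ e, ¬ Touch U e → g e = g' e) →
      (SAW g r w U ↔ SAW g' r w U) := by
  induction r with
  | zero => intros; rfl
  | succ r ih =>
    intro w U hw h
    refine exists_congr fun z => and_congr_right fun hz => and_congr ?_ (ih hz fun e he => ?_)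
    · refine exists_congr fun hne => ?_
      rw [h]
      rw [touch_ed]
      simp_all
    · refine h e fun ht => he ?_
      rcases ht with ht | ht
      · exact Or.inl (Or.inr ht)
      · exact Or.inr (Or.inr ht)

lemma exp_neg_tangent (x m : ℝ) : Real.exp (-m) * (1 - (x - m)) ≤ Real.exp (-x) := by
  have h : Real.exp (-x) = Real.exp (-m) * Real.exp (-(x - m)) := by
    rw [← Real.exp_add]; congr 1; ring
  rw [h]
  refine mul_le_mul_of_nonneg_left ?_ (Real.exp_pos _).le
  have := Real.add_one_le_exp (-(x - m))
  linarith

lemma EX_none_open {ι : Type*} [Fintype ι] (p : ℝ) (Q : ι → Prop) :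
    EX (bw fun _ : ι => p) (fun a => ∏ e, (if Q e then (if a e then (0 : ℝ) else 1) else 1)) =
      (1 - p) ^ (Finset.univ.filter Q).card := by
  refine (EX_prod (bw fun _ : ι => p)
    (fun (e : ι) (c : Bool) => if Q e then (if c then (0 : ℝ) else 1) else 1)).trans ?_
  rw [← Finset.prod_const, Finset.prod_filter]
  refine Finset.prod_congr rfl fun e _ => ?_
  by_cases h : Q e <;> simp [h, bw]

/-- Bound on the probability of a self-avoiding walk of length `r`, by comparison with the
survival of a Poisson branching process with offspring mean `m`. -/
noncomputable def surv (m : ℝ) : ℕ → ℝ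
  | 0 => 1
  | r + 1 => 1 - Real.exp (-(m * surv m r))

lemma surv_nonneg {m : ℝ} (hm : 0 ≤ m) (r : ℕ) : 0 ≤ surv m r := by
  induction r with
  | zero => simp [surv]
  | succ r ih =>
    simp only [surv, sub_nonneg, Real.exp_le_one_iff, neg_nonpos]
    positivity

lemma EX_SAW_le {n : ℕ} {p c : ℝ} (hp0 : 0 ≤ p) (hp1 : p ≤ 1) (hc : Real.exp (-c) ≤ 1 - p)
    (hc0 : 0 ≤ c) (r : ℕ) : ∀ (w : Fin n) (U : Set (Fin n)),
      EX (bw fun _ : VPair n => p) (fun g => if SAW g r w U then 1 else 0) ≤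
        surv (n * c) r := by
  have hb := bw_nonneg (p := fun _ : VPair n => p) (fun _ => hp0) (fun _ => hp1)
  induction r with
  | zero =>
    intro w U
    simp [SAW, surv, EX_const (bw_sum _)]
  | succ r ih =>
    intro w U
    set Good : (VPair n → Bool) → VPair n → Prop := fun b e =>
      ∃ z, ∃ h : w ≠ z, e = ed w z h ∧ z ∉ insert w U ∧ SAW b r z (insert w U) with hGood
    set Z : (VPair n → Bool) → ℝ := fun b =>
      ∑ z, if z ∉ insert w U ∧ SAW b r z (insert w U) then 1 else 0 with hZ
    set P : VPair n → Prop := fun e => Touch {w} e with hP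
    have hloc : ∀ a b z, z ∉ insert w U →
        (SAW (mix P a b) r z (insert w U) ↔ SAW b r z (insert w U)) := by
      intro a b z hz
      refine SAW_congr hz fun e he => ?_
      have : ¬ P e := by
        intro h
        apply he
        rcases h with h | h
        · exact Or.inl (Or.inl h)
        · exact Or.inr (Or.inl h)
      simp [mix, this]
    have hind : ∀ a b, (if SAW (mix P a b) (r + 1) w U then (1 : ℝ) else 0) =
        1 - ∏ e, (if Good b e then (if a e then (0 : ℝ) else 1) else 1) := by
      intro a b
      by_cases hs : SAW (mix P a b) (r + 1) w U
      · obtain ⟨z, hz, ⟨hne, hg⟩, hS⟩ := hs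
        have hs : SAW (mix P a b) (r + 1) w U := ⟨z, hz, ⟨hne, hg⟩, hS⟩
        have hPe : P (ed w z hne) := (touch_ed _ _ _ _).mpr (Or.inl rfl)
        have : ∏ e, (if Good b e then (if a e then (0 : ℝ) else 1) else 1) = 0 := by
          refine Finset.prod_eq_zero (Finset.mem_univ (ed w z hne)) ?_
          rw [if_pos ⟨z, hne, rfl, hz, (hloc a b z hz).mp hS⟩]
          simpa [mix, hPe] using hg
        rw [if_pos hs, this]
        simp
      · have : ∏ e, (if Good b e then (if a e then (0 : ℝ) else 1) else 1) = 1 := by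
          refine Finset.prod_eq_one fun e _ => ?_
          split_ifs with h1 h2
          · exfalso
            obtain ⟨z, hne, rfl, hz, hS⟩ := h1
            have hPe : P (ed w z hne) := (touch_ed _ _ _ _).mpr (Or.inl rfl)
            exact hs ⟨z, hz, ⟨hne, by simpa [mix, hPe] using h2⟩, (hloc a b z hz).mpr hS⟩
          · rfl
          · rfl
        rw [if_neg hs, this]
        simp
    have hcard : ∀ b, ((Finset.univ.filter (Good b)).card : ℝ) ≤ Z b := by
      intro b
      simp only [hZ, Finset.sum_boole]
      norm_cast
      refine Finset.card_le_card_of_injOn (fun e => if e.1.1 = w then e.1.2 else e.1.1) ?_ ?_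
      · intro e he
        simp only [Finset.coe_filter, Finset.mem_univ, true_and, Set.mem_ofPred_eq] at he ⊢
        obtain ⟨z, hne, rfl, hz⟩ := he
        have : (if (ed w z hne).1.1 = w then (ed w z hne).1.2 else (ed w z hne).1.1) = z := by
          unfold ed
          split_ifs <;> simp_all
        rw [this]
        exact hz
      · intro e he e' he' h
        simp only [Finset.coe_filter, Finset.mem_univ, true_and, Set.mem_ofPred_eq] at he he'
        obtain ⟨z, hne, rfl, hz⟩ := he
        obtain ⟨z', hne', rfl, hz'⟩ := he'
        have hh : ∀ z (hne : w ≠ z),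
            (if (ed w z hne).1.1 = w then (ed w z hne).1.2 else (ed w z hne).1.1) = z := by
          intro z hne
          unfold ed
          split_ifs <;> simp_all
        simp only [hh] at h
        subst h
        rfl
    have hprod : ∀ b, EX (bw fun _ : VPair n => p) (fun a =>
        ∏ e, (if Good b e then (if a e then (0 : ℝ) else 1) else 1)) =
          (1 - p) ^ (Finset.univ.filter (Good b)).card := by
      intro b
      convert EX_none_open p (Good b)
    rw [← EX_mix_self (bw_sum _) P, EX_comm]
    simp only [hind]
    set m := n * c * surv (n * c) r with hm
    have hZle : c * EX (bw fun _ : VPair n => p) Z ≤ m := by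
      have : EX (bw fun _ : VPair n => p) Z ≤ n * surv (n * c) r := by
        rw [hZ, EX_sum]
        refine (Finset.sum_le_card_nsmul _ _ (surv (n * c) r) fun z _ => ?_).trans (by simp)
        refine le_trans (EX_mono hb fun ω => ?_) (ih z (insert w U))
        by_cases h : SAW ω r z (insert w U)
        · simp only [h]; split_ifs <;> simp_all
        · simp [h]
      calc _ ≤ c * (n * surv (n * c) r) := by gcongr
        _ = m := by rw [hm]; ring
    calc EX (bw fun _ : VPair n => p) (fun b => EX (bw fun _ : VPair n => p) fun a =>
          1 - ∏ e, (if Good b e then (if a e then (0 : ℝ) else 1) else 1))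
        ≤ EX (bw fun _ : VPair n => p) (fun b =>
          1 - Real.exp (-m) * (1 + m) + Real.exp (-m) * c * Z b) := by
          refine EX_mono hb fun b => ?_
          rw [EX_sub, EX_const (bw_sum _), hprod]
          have h1 : Real.exp (-(c * Z b)) ≤ (1 - p) ^ (Finset.univ.filter (Good b)).card := by
            calc Real.exp (-(c * Z b)) ≤
                Real.exp (((Finset.univ.filter (Good b)).card : ℝ) * (-c)) := by
                  apply Real.exp_le_exp.mpr
                  have := mul_le_mul_of_nonneg_left (hcard b) hc0
                  linarith
              _ = Real.exp (-c) ^ (Finset.univ.filter (Good b)).card := by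
                  rw [← Real.exp_nat_mul]
              _ ≤ _ := pow_le_pow_left₀ (Real.exp_pos _).le hc _
          have h2 := exp_neg_tangent (c * Z b) m
          linarith
      _ = 1 - Real.exp (-m) * (1 + m) + Real.exp (-m) * (c * EX (bw fun _ : VPair n => p) Z) := by
          rw [EX_add, EX_const (bw_sum _), EX_const_mul]
          ring
      _ ≤ 1 - Real.exp (-m) * (1 + m) + Real.exp (-m) * m := by
          have := mul_le_mul_of_nonneg_left hZle (Real.exp_pos (-m)).le
          linarith
      _ = surv (n * c) (r + 1) := by
          simp only [surv, hm]
          ring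

lemma surv_le_surv_add {m η : ℝ} (hη : 0 ≤ η) (hm0 : 0 ≤ m) (hm : m ≤ 1 + η) (r : ℕ) :
    surv m r ≤ surv 1 r + r * η := by
  induction r with
  | zero => simp [surv]
  | succ r ih =>
    have h1 : surv m r ≤ 1 := by
      cases r with
      | zero => simp [surv]
      | succ r => simp only [surv]; linarith [Real.exp_pos (-(m * surv m r))]
    have h0 := surv_nonneg hm0 r
    have h01 := surv_nonneg (m := 1) (by norm_num) r
    have h2 : m * surv m r ≤ surv 1 r + (r + 1) * η := by
      nlinarith
    simp only [surv]
    have h3 := exp_neg_tangent (m * surv m r) (1 * surv 1 r)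
    have h4 : Real.exp (-(1 * surv 1 r)) ≤ 1 := by
      rw [Real.exp_le_one_iff]; linarith
    have h5 := Real.exp_pos (-(1 * surv 1 r))
    have h6 : m * surv m r - 1 * surv 1 r ≤ (r + 1) * η := by linarith
    have h7 : 0 ≤ (r + 1 : ℝ) * η := by positivity
    push_cast
    nlinarith

lemma tendsto_surv_one : Tendsto (surv 1) atTop (nhds 0) := by
  have hanti : Antitone (surv 1) := by
    refine antitone_nat_of_succ_le fun r => ?_
    simp only [surv]
    have := Real.add_one_le_exp (-(1 * surv 1 r))
    linarith
  have hbdd : BddBelow (Set.range (surv 1)) :=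
    ⟨0, by rintro _ ⟨r, rfl⟩; exact surv_nonneg (by norm_num) r⟩
  have hl := tendsto_atTop_ciInf hanti hbdd
  set l := ⨅ r, surv 1 r with hdef
  have h1 : Tendsto (fun r => surv 1 (r + 1)) atTop (nhds (1 - Real.exp (-(1 * l)))) := by
    simp only [surv]
    exact tendsto_const_nhds.sub ((Real.continuous_exp.tendsto _).comp ((hl.const_mul 1).neg))
  have h2 := tendsto_nhds_unique h1 (hl.comp (tendsto_add_atTop_nat 1))
  by_contra hne
  have hl0 : l ≠ 0 := fun h => hne (h ▸ hl)
  have := Real.add_one_lt_exp (x := -(1 * l)) (by simpa using hl0)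
  linarith

/-- Vertices reached from `w` by self-avoiding walks of length at most `r` avoiding `U`. -/
noncomputable def reach {n : ℕ} (g : VPair n → Bool) :
    ℕ → Fin n → Set (Fin n) → Finset (Fin n)
  | 0, w, _ => {w}
  | r + 1, w, U => insert w ((Finset.univ.filter fun z => z ∉ insert w U ∧ (Gr g).Adj w z).biUnion
      fun z => reach g r z (insert w U))

lemma reach_congr {n : ℕ} {g g' : VPair n → Bool} {r : ℕ} :
    ∀ {w : Fin n} {U : Set (Fin n)}, w ∉ U → (∀ e, ¬ Touch U e → g e = g' e) →
      reach g r w U = reach g' r w U := by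
  induction r with
  | zero => intros; rfl
  | succ r ih =>
    intro w U hw h
    have h1 : ∀ z, z ∉ insert w U → ((Gr g).Adj w z ↔ (Gr g').Adj w z) := by
      intro z hz
      refine exists_congr fun hne => ?_
      rw [h]
      rw [touch_ed]
      simp_all
    simp only [reach]
    congr 1
    refine Finset.biUnion_congr ?_ fun z hz => ?_
    · ext z
      simp only [Finset.mem_filter, Finset.mem_univ, true_and]
      exact and_congr_right (h1 z)
    · simp only [Finset.mem_filter, Finset.mem_univ, true_and] at hz
      refine ih hz.1 fun e he => ?_
      refine h e fun ht => he ?_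
      rcases ht with ht | ht
      · exact Or.inl (Or.inr ht)
      · exact Or.inr (Or.inr ht)

lemma self_mem_reach {n : ℕ} (g : VPair n → Bool) (r : ℕ) (w : Fin n) (U : Set (Fin n)) :
    w ∈ reach g r w U := by
  cases r <;> simp [reach]

lemma mem_reach_of_isPath {n : ℕ} {g : VPair n → Bool} {w z : Fin n} (p : (Gr g).Walk w z) :
    ∀ {r : ℕ} {U : Set (Fin n)}, p.IsPath → p.length ≤ r → (∀ v ∈ p.support, v ∉ U) →
      z ∈ reach g r w U := by
  induction p with
  | nil => intros; exact self_mem_reach ..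
  | @cons x y z h p ih =>
    intro r U hp hr hU
    cases r with
    | zero => simp at hr
    | succ r =>
      rw [SimpleGraph.Walk.cons_isPath_iff] at hp
      have hav : ∀ v ∈ p.support, v ∉ insert x U := by
        intro v hv hmem
        rcases hmem with rfl | hmem
        · exact hp.2 hv
        · exact hU v (by simp [hv]) hmem
      simp only [reach, Finset.mem_insert, Finset.mem_biUnion, Finset.mem_filter,
        Finset.mem_univ, true_and]
      exact Or.inr ⟨y, ⟨hav _ p.start_mem_support, h⟩, ih hp.1 (by simpa using hr) hav⟩

lemma ball_subset_reach {n : ℕ} (g : VPair n → Bool) (u : Fin n) (r : ℕ) :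
    ball g u r ⊆ reach g r u ∅ := by
  intro z hz
  obtain ⟨p, hp⟩ := exists_walk_of_mem_ball hz
  refine mem_reach_of_isPath p.toPath.1 p.toPath.2 ?_ (by simp)
  exact (SimpleGraph.Walk.length_bypass_le_length p).trans hp

lemma EX_open_mul {ι : Type*} [Fintype ι] (p : ι → ℝ) (e : ι) (F : (ι → Bool) → ℝ)
    (hF : ∀ g g', (∀ i, i ≠ e → g i = g' i) → F g = F g') :
    EX (bw p) (fun g => if g e then F g else 0) = p e * EX (bw p) F := by
  rw [EX_resample p e (fun g => if g e then F g else 0), ← EX_const_mul]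
  congr 1
  funext g
  have : F (Function.update g e true) = F g := hF _ _ fun i hi => Function.update_of_ne hi _ _
  simp [this]

lemma EX_card_reach_le {n : ℕ} {p : VPair n → ℝ} {c : ℝ} (hp0 : ∀ e, 0 ≤ p e)
    (hp1 : ∀ e, p e ≤ 1) (hpc : ∀ e, p e ≤ c) (hc : 0 ≤ c) (r : ℕ) :
    ∀ (w : Fin n) (U : Set (Fin n)), w ∉ U → EX (bw p) (fun g => ((reach g r w U).card : ℝ)) ≤
        ∑ i ∈ Finset.range (r + 1), (n * c) ^ i := by
  have hb := bw_nonneg hp0 hp1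
  induction r with
  | zero => intro w U _; simp [reach, EX_const (bw_sum _)]
  | succ r ih =>
    intro w U _
    set B := ∑ i ∈ Finset.range (r + 1), (n * c) ^ i with hB
    have hB0 : 0 ≤ B := Finset.sum_nonneg fun i _ => by positivity
    set T := Finset.univ.filter fun z => z ∉ insert w U with hT
    have h1 : ∀ g, ((reach g (r + 1) w U).card : ℝ) ≤
        1 + ∑ z ∈ T, if h : w ≠ z then
          (if g (ed w z h) then ((reach g r z (insert w U)).card : ℝ) else 0) else 0 := by
      intro g
      simp only [reach]
      refine (Nat.cast_le.mpr (Finset.card_insert_le _ _)).trans ?_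
      push_cast
      rw [add_comm]
      refine add_le_add le_rfl ((Nat.cast_le.mpr Finset.card_biUnion_le).trans ?_)
      push_cast
      rw [hT, Finset.sum_filter, Finset.sum_filter]
      refine Finset.sum_le_sum fun z _ => ?_
      by_cases hz : z ∉ insert w U
      · by_cases hne : w ≠ z
        · have : (Gr g).Adj w z ↔ g (ed w z hne) = true :=
            ⟨fun ⟨_, h⟩ => h, fun h => ⟨hne, h⟩⟩
          simp only [hz, hne, this, not_false_eq_true, true_and, if_true, dif_pos, ne_eq]
          exact le_rfl
        · exact absurd (Or.inl (not_not.mp hne).symm) hz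
      · rw [if_neg (fun h => hz h.1), if_neg hz]
    refine (EX_mono hb h1).trans ?_
    rw [EX_add, EX_const (bw_sum _), EX_sum, Finset.sum_range_succ']
    have h2 : ∀ z ∈ T, EX (bw p) (fun g => if h : w ≠ z then
          (if g (ed w z h) then ((reach g r z (insert w U)).card : ℝ) else 0) else 0) ≤ c * B := by
      intro z hz
      simp only [hT, Finset.mem_filter, Finset.mem_univ, true_and] at hz
      have hne : w ≠ z := fun h => hz (h ▸ Or.inl rfl)
      simp only [hne, ne_eq, not_false_eq_true, dif_pos]
      rw [EX_open_mul p (ed w z hne) (fun g => ((reach g r z (insert w U)).card : ℝ))]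
      · exact mul_le_mul (hpc _) (ih z _ hz) (EX_nonneg hb fun _ => by positivity) hc
      · intro g g' h
        rw [reach_congr hz]
        intro e he
        refine h e ?_
        rintro rfl
        exact he ((touch_ed _ _ _ _).mpr (Or.inl (Or.inl rfl)))
    have h3 : ∑ z ∈ T, EX (bw p) (fun g => if h : w ≠ z then
          (if g (ed w z h) then ((reach g r z (insert w U)).card : ℝ) else 0) else 0) ≤
          n * (c * B) := by
      refine (Finset.sum_le_card_nsmul _ _ _ h2).trans ?_
      rw [nsmul_eq_mul]
      have : (T.card : ℝ) ≤ n := by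
        exact_mod_cast (Finset.card_le_univ T).trans (by simp)
      exact mul_le_mul_of_nonneg_right this (by positivity)
    have h4 : ∑ i ∈ Finset.range (r + 1), (n * c : ℝ) ^ (i + 1) = n * (c * B) := by
      rw [hB, Finset.mul_sum, Finset.mul_sum]
      exact Finset.sum_congr rfl fun i _ => by ring
    rw [h4]
    simp only [pow_zero]
    linarith

lemma EX_card_ball_le {n : ℕ} {p : VPair n → ℝ} {c : ℝ} (hp0 : ∀ e, 0 ≤ p e)
    (hp1 : ∀ e, p e ≤ 1) (hpc : ∀ e, p e ≤ c) (hc : 0 ≤ c) (u : Fin n) (r : ℕ) :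
    EX (bw p) (fun g => ((ball g u r).card : ℝ)) ≤ ∑ i ∈ Finset.range (r + 1), (n * c) ^ i :=
  (EX_mono (bw_nonneg hp0 hp1) fun g => by
    exact_mod_cast Finset.card_le_card (ball_subset_reach g u r)).trans
    (EX_card_reach_le hp0 hp1 hpc hc r u ∅ (by simp))

/-- The pairs with both ends in `S`. -/
noncomputable def pairsIn {n : ℕ} (S : Finset (Fin n)) : Finset (VPair n) :=
  Finset.univ.filter fun e => e.1.1 ∈ S ∧ e.1.2 ∈ S

lemma card_pairsIn_le {n : ℕ} (S : Finset (Fin n)) : (pairsIn S).card ≤ S.card ^ 2 := by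
  rw [sq, ← Finset.card_product]
  refine Finset.card_le_card_of_injOn (fun e => e.1) ?_ (fun e _ e' _ h => Subtype.ext h)
  intro e he
  simp only [pairsIn, Finset.coe_filter, Finset.mem_univ, true_and, Set.mem_ofPred_eq] at he
  simpa using he

/-- Some set of at most `K + 1` vertices containing `u` spans at least as many open pairs as it
has vertices. -/
def Excess {n : ℕ} (K : ℕ) (u : Fin n) (g : VPair n → Bool) : Prop :=
  ∃ T : Finset (Fin n), T.card ≤ K ∧
    T.card + 1 ≤ ((pairsIn (insert u T)).filter fun e => g e = true).card

lemma EX_all_open {ι : Type*} [Fintype ι] (p : ι → ℝ) (A : Finset ι) :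
    EX (bw p) (fun g => if ∀ e ∈ A, g e = true then 1 else 0) = ∏ e ∈ A, p e := by
  have h := EX_prod (bw p) (fun (e : ι) (c : Bool) => if e ∈ A then (if c then (1 : ℝ) else 0) else 1)
  have h1 : ∀ g : ι → Bool, (∏ e, if e ∈ A then (if g e then (1 : ℝ) else 0) else 1) =
      if ∀ e ∈ A, g e = true then 1 else 0 := by
    intro g
    rw [Finset.prod_ite_mem, Finset.univ_inter, Finset.prod_ite_zero]
    simp
  simp only [h1] at h
  rw [h, ← Finset.prod_subset (Finset.subset_univ A)]
  · exact Finset.prod_congr rfl fun e he => by simp [he, bw]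
  · intro e _ he
    simp [he, bw]

lemma EX_excess_le {n : ℕ} {p : VPair n → ℝ} {c : ℝ} (hp0 : ∀ e, 0 ≤ p e)
    (hp1 : ∀ e, p e ≤ 1) (hpc : ∀ e, p e ≤ c) (hc : 0 ≤ c) (K : ℕ) (u : Fin n) :
    n * EX (bw p) (fun g => if Excess K u g then 1 else 0) ≤
      ∑ t ∈ Finset.range (K + 1), ((K + 1) ^ 2 * (n * c)) ^ (t + 1) := by
  have hb := bw_nonneg hp0 hp1
  have h1 : ∀ g, (if Excess K u g then (1 : ℝ) else 0) ≤
      ∑ t ∈ Finset.range (K + 1), ∑ T ∈ Finset.powersetCard t Finset.univ,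
        ∑ A ∈ Finset.powersetCard (t + 1) (pairsIn (insert u T)),
          if ∀ e ∈ A, g e = true then 1 else 0 := by
    intro g
    have hA : ∀ A : Finset (VPair n), (0 : ℝ) ≤ if ∀ e ∈ A, g e = true then 1 else 0 := by
      intro A; split_ifs <;> norm_num
    by_cases h : Excess K u g
    · rw [if_pos h]
      obtain ⟨T, hT, hcard⟩ := h
      obtain ⟨A, hA1, hA2⟩ := Finset.exists_subset_card_eq hcard
      refine le_trans ?_ (Finset.single_le_sum (f := fun t => ∑ T ∈ Finset.powersetCard t Finset.univ,
        ∑ A ∈ Finset.powersetCard (t + 1) (pairsIn (insert u T)),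
          if ∀ e ∈ A, g e = true then (1 : ℝ) else 0)
        (fun t _ => Finset.sum_nonneg fun T _ => Finset.sum_nonneg fun A _ => hA A)
        (Finset.mem_range.mpr (Nat.lt_succ_of_le hT)))
      refine le_trans ?_ (Finset.single_le_sum (f := fun T' =>
        ∑ A ∈ Finset.powersetCard (T.card + 1) (pairsIn (insert u T')),
          if ∀ e ∈ A, g e = true then (1 : ℝ) else 0)
        (fun T _ => Finset.sum_nonneg fun A _ => hA A)
        (Finset.mem_powersetCard.mpr ⟨Finset.subset_univ T, rfl⟩))
      refine le_trans ?_ (Finset.single_le_sum (f := fun A =>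
          if ∀ e ∈ A, g e = true then (1 : ℝ) else 0)
        (fun A _ => hA A)
        (Finset.mem_powersetCard.mpr ⟨fun e he => (Finset.mem_filter.mp (hA1 he)).1, hA2⟩))
      rw [if_pos fun e he => (Finset.mem_filter.mp (hA1 he)).2]
    · rw [if_neg h]
      exact Finset.sum_nonneg fun t _ => Finset.sum_nonneg fun T _ =>
        Finset.sum_nonneg fun A _ => hA A
  have h2 : EX (bw p) (fun g => if Excess K u g then 1 else 0) ≤
      ∑ t ∈ Finset.range (K + 1), (n : ℝ) ^ t * (((K + 1) ^ 2) ^ (t + 1) * c ^ (t + 1)) := by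
    refine (EX_mono hb h1).trans ?_
    rw [EX_sum]
    refine Finset.sum_le_sum fun t ht => ?_
    rw [EX_sum]
    have hin : ∀ T ∈ Finset.powersetCard t (Finset.univ : Finset (Fin n)),
        EX (bw p) (fun g => ∑ A ∈ Finset.powersetCard (t + 1) (pairsIn (insert u T)),
          if ∀ e ∈ A, g e = true then 1 else 0) ≤ ((K + 1) ^ 2) ^ (t + 1) * c ^ (t + 1) := by
      intro T hT
      rw [EX_sum]
      have hone : ∀ A ∈ Finset.powersetCard (t + 1) (pairsIn (insert u T)),
          EX (bw p) (fun g => if ∀ e ∈ A, g e = true then 1 else 0) ≤ c ^ (t + 1) := by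
        intro A hA
        have h5 : EX (bw p) (fun g => if ∀ e ∈ A, g e = true then 1 else 0) = ∏ e ∈ A, p e := by
          convert EX_all_open p A
        rw [h5, ← (Finset.mem_powersetCard.mp hA).2, ← Finset.prod_const]
        exact Finset.prod_le_prod (fun e _ => hp0 e) fun e _ => hpc e
      refine (Finset.sum_le_card_nsmul _ _ _ hone).trans ?_
      rw [nsmul_eq_mul, Finset.card_powersetCard]
      refine mul_le_mul_of_nonneg_right ?_ (by positivity)
      have h3 : (pairsIn (insert u T)).card ≤ (K + 1) ^ 2 := by
        refine (card_pairsIn_le _).trans (Nat.pow_le_pow_left ?_ 2)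
        refine (Finset.card_insert_le _ _).trans ?_
        have := (Finset.mem_powersetCard.mp hT).2
        have := Finset.mem_range.mp ht
        omega
      have h4 : (pairsIn (insert u T)).card.choose (t + 1) ≤ ((K + 1) ^ 2) ^ (t + 1) :=
        (Nat.choose_le_pow _ _).trans (Nat.pow_le_pow_left h3 _)
      exact_mod_cast h4
    refine (Finset.sum_le_card_nsmul _ _ _ hin).trans ?_
    rw [nsmul_eq_mul, Finset.card_powersetCard]
    refine mul_le_mul_of_nonneg_right ?_ (by positivity)
    have := Nat.choose_le_pow (Fintype.card (Fin n)) t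
    rw [Fintype.card_fin] at this
    simpa using (by exact_mod_cast this : ((n.choose t : ℕ) : ℝ) ≤ (n : ℝ) ^ t)
  refine (mul_le_mul_of_nonneg_left h2 (Nat.cast_nonneg n)).trans ?_
  rw [Finset.mul_sum]
  refine le_of_eq (Finset.sum_congr rfl fun t _ => ?_)
  rw [mul_pow, mul_pow]
  ring

lemma card_le_of_reachable {n : ℕ} {h : VPair n → Bool} {u : Fin n} (S : Finset (Fin n))
    (hS : ∀ v ∈ S, (Gr h).Reachable u v) :
    S.card ≤ (Finset.univ.filter fun e => h e = true).card + 1 := by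
  have key : ∀ v ∈ S.erase u, ∃ w, ∃ hne : v ≠ w, h (ed v w hne) = true ∧
      (Gr h).dist u w < (Gr h).dist u v := by
    intro v hv
    rw [Finset.mem_erase] at hv
    obtain ⟨p, hp⟩ := (hS v hv.2).exists_walk_length_eq_dist
    have hnil : ¬ p.Nil := SimpleGraph.Walk.not_nil_of_ne hv.1.symm
    obtain ⟨hne, hg⟩ := (p.adj_penultimate hnil).symm
    refine ⟨p.penultimate, hne, hg, ?_⟩
    have h1 := SimpleGraph.dist_le p.dropLast
    have h2 := SimpleGraph.Walk.length_dropLast_add_one hnil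
    omega
  choose w hne hw hd using key
  have : (S.erase u).card ≤ (Finset.univ.filter fun e => h e = true).card := by
    rw [← Finset.card_attach]
    refine Finset.card_le_card_of_injOn
      (fun v => ed v.1 (w v.1 v.2) (hne v.1 v.2)) (fun v _ => by simp [hw]) ?_
    rintro ⟨v, hv⟩ _ ⟨v', hv'⟩ _ heq
    by_contra hvv
    have hvv' : v ≠ v' := fun h => hvv (Subtype.ext h)
    have h1 := hd v hv
    have h2 := hd v' hv'
    have h3 : v = w v' hv' ∧ w v hv = v' := by
      simp only [ed] at heq
      split_ifs at heq <;> simp only [Subtype.mk.injEq, Prod.mk.injEq] at heq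
      · exact absurd heq.1 hvv'
      · exact heq
      · exact heq.symm
      · exact absurd heq.2 hvv'
    rw [← h3.1] at h2
    rw [h3.2] at h1
    omega
  have h3 := Finset.pred_card_le_card_erase (s := S) (a := u)
  omega

lemma reachable_rest {n : ℕ} (g : VPair n → Bool) (u : Fin n) (r : ℕ) :
    ∀ i ≤ r + 1, ∀ z ∈ ball g u i, (Gr (rest (ball g u r) g)).Reachable u z := by
  intro i
  induction i with
  | zero =>
    intro _ z hz
    simp only [ball, Finset.mem_singleton] at hz
    rw [hz]
  | succ i ih =>
    intro hi z hz
    simp only [ball, Finset.mem_filter, Finset.mem_univ, true_and] at hz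
    rcases hz with hz | ⟨w, hw, hne, hg⟩
    · exact ih (by omega) z hz
    · refine (ih (by omega) w hw).trans (SimpleGraph.Adj.reachable ⟨hne, ?_⟩)
      have hwD : w ∈ ball g u r := ball_mono g u (by omega) hw
      simp [rest, hg, touch_ed, hwD]

lemma rest_subset {n : ℕ} (g : VPair n → Bool) (u : Fin n) (r : ℕ) (e : VPair n)
    (he : rest (ball g u r) g e = true) :
    e ∈ (pairsIn (ball g u (r + 1))).filter fun e => g e = true := by
  simp only [rest, Bool.and_eq_true, decide_eq_true_eq] at he
  have hadj := Gr_adj he.1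
  simp only [pairsIn, Finset.mem_filter, Finset.mem_univ, true_and]
  refine ⟨?_, he.1⟩
  rcases he.2 with h | h
  · exact ⟨ball_subset_succ g u r h, mem_ball_of_adj h hadj⟩
  · exact ⟨mem_ball_of_adj h hadj.symm, ball_subset_succ g u r h⟩

lemma forest_of_not_excess {n K : ℕ} {g : VPair n → Bool} {u : Fin n} {r : ℕ}
    (hK : (ball g u (r + 1)).card ≤ K) (hE : ¬ Excess K u g) : Forest (rest (ball g u r) g) := by
  set h := rest (ball g u r) g with hh
  set S := ball g u (r + 1) with hS
  intro e he
  set h' : VPair n → Bool := fun e' => h e' && decide (e' ≠ e) with hh'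
  have hadj : ∀ e', e' ≠ e → h e' = true → (Gr h').Adj e'.1.1 e'.1.2 := by
    intro e' h1 h2
    exact Gr_adj (by simp [hh', h1, h2])
  refine ⟨{v | (Gr h').Reachable e.1.1 v}, ?_, ?_⟩
  · intro hcr
    have hr : (Gr h').Reachable e.1.1 e.1.2 := hcr.mp (SimpleGraph.Reachable.refl _)
    have htr : ∀ x y, (Gr h).Adj x y → (Gr h').Reachable x y := by
      rintro x y ⟨hne, hg⟩
      by_cases hxe : ed x y hne = e
      · unfold ed at hxe
        split_ifs at hxe
        · subst hxe; exact hr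
        · subst hxe; exact hr.symm
      · exact SimpleGraph.Adj.reachable ⟨hne, by simp [hh', hxe, hg]⟩
    have htr2 : ∀ x y, (Gr h).Reachable x y → (Gr h').Reachable x y := by
      rintro x y ⟨p⟩
      induction p with
      | nil => exact SimpleGraph.Reachable.refl _
      | cons h1 p ih => exact (htr _ _ h1).trans ih
    have hcard := card_le_of_reachable S fun v hv =>
      htr2 u v (reachable_rest g u r (r + 1) le_rfl v hv)
    have huS : u ∈ S := mem_ball_self g u (r + 1)
    have hlt : (Finset.univ.filter fun e => h' e = true).card <
        ((pairsIn S).filter fun e => g e = true).card := by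
      refine Finset.card_lt_card ⟨fun e' he' => ?_, fun hsub => ?_⟩
      · simp only [hh', Bool.and_eq_true, Finset.mem_filter] at he'
        exact rest_subset g u r e' he'.2.1
      · have := hsub (rest_subset g u r e he)
        simp [hh'] at this
    refine hE ⟨S.erase u, (Finset.card_erase_le).trans hK, ?_⟩
    rw [Finset.insert_erase huS, Finset.card_erase_add_one huS]
    omega
  · intro e' h1 h2 hcr
    have := (hadj e' h1 h2).reachable
    exact hcr ⟨fun h3 => h3.trans this, fun h3 => h3.trans this.symm⟩

lemma sum_vpair {n : ℕ} (F : Fin n × Fin n → ℝ) :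
    ∑ e : VPair n, F e.1 = ∑ p : Fin n × Fin n, if p.1 < p.2 then F p else 0 := by
  rw [← Finset.sum_filter]
  exact (Finset.sum_subtype (Finset.univ.filter fun p : Fin n × Fin n => p.1 < p.2)
    (by simp) F).symm

lemma sq_sum_eq {n : ℕ} (f : Fin n → ℝ) :
    (∑ i, f i) ^ 2 = ∑ i, f i ^ 2 + 2 * ∑ e : VPair n, f e.1.1 * f e.1.2 := by
  have h1 : (∑ i, f i) ^ 2 = ∑ p : Fin n × Fin n, f p.1 * f p.2 := by
    rw [sq, Finset.sum_mul_sum, Fintype.sum_prod_type]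
  have h2 : ∀ p : Fin n × Fin n, f p.1 * f p.2 = (if p.1 = p.2 then f p.1 * f p.2 else 0) +
      ((if p.1 < p.2 then f p.1 * f p.2 else 0) + (if p.2 < p.1 then f p.2 * f p.1 else 0)) := by
    intro p
    rcases lt_trichotomy p.1 p.2 with h | h | h
    · simp [h, h.ne, h.not_gt]
    · simp [h]
    · simp [h, h.ne', h.not_gt, mul_comm]
  rw [h1, Finset.sum_congr rfl fun p _ => h2 p, Finset.sum_add_distrib, Finset.sum_add_distrib,
    sum_vpair (fun p => f p.1 * f p.2)]
  have h3 : ∑ p : Fin n × Fin n, (if p.2 < p.1 then f p.2 * f p.1 else 0) =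
      ∑ p : Fin n × Fin n, (if p.1 < p.2 then f p.1 * f p.2 else 0) :=
    Fintype.sum_equiv (Equiv.prodComm _ _) _ _ fun p => by
      simp only [Equiv.prodComm_apply, Prod.fst_swap, Prod.snd_swap]
      congr
  have h4 : ∑ p : Fin n × Fin n, (if p.1 = p.2 then f p.1 * f p.2 else 0) = ∑ i, f i ^ 2 := by
    rw [Fintype.sum_prod_type]
    refine Finset.sum_congr rfl fun i _ => ?_
    simp [sq]
  rw [h3, h4]
  ring

/-- Sum of the spins off `D`. -/
noncomputable def sOut {n : ℕ} (D : Finset (Fin n)) (x : Fin n → Fin 2) : ℝ :=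
  ∑ i, if i ∈ D then 0 else sg (x i)

lemma abs_sum_sg_le {n : ℕ} (D : Finset (Fin n)) (x : Fin n → Fin 2) :
    |∑ i ∈ D, sg (x i)| ≤ D.card := by
  refine (Finset.abs_sum_le_sum_abs _ _).trans ?_
  simp [abs_sg]

lemma sum_sg_eq {n : ℕ} (D : Finset (Fin n)) (x : Fin n → Fin 2) :
    ∑ i, sg (x i) = ∑ i ∈ D, sg (x i) + sOut D x := by
  unfold sOut
  rw [← Finset.sum_filter_add_sum_filter_not Finset.univ (· ∈ D)]
  congr 1
  · simp
  · rw [Finset.sum_filter]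
    exact Finset.sum_congr rfl fun i _ => by by_cases h : i ∈ D <;> simp [h]

lemma sum_spin_touch {n : ℕ} (D : Finset (Fin n)) (x : Fin n → Fin 2) :
    2 * ∑ e : VPair n, (if Touch (D : Set (Fin n)) e then spin e x else 0) =
      (∑ i ∈ D, sg (x i)) ^ 2 + 2 * (∑ i ∈ D, sg (x i)) * sOut D x - D.card := by
  have h1 := sq_sum_eq (fun i => sg (x i))
  have h2 := sq_sum_eq (fun i => if i ∈ D then 0 else sg (x i))
  have h3 : ∑ i, sg (x i) ^ 2 = n := by simp [sg_sq]
  have h4 : ∑ i : Fin n, (if i ∈ D then 0 else sg (x i)) ^ 2 = n - D.card := by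
    have : ∀ i : Fin n, (if i ∈ D then 0 else sg (x i)) ^ 2 = 1 - if i ∈ D then (1 : ℝ) else 0 := by
      intro i
      split_ifs <;> simp [sg_sq]
    simp [this]
  have h5 : ∑ e : VPair n, (if Touch (D : Set (Fin n)) e then spin e x else 0) =
      ∑ e : VPair n, sg (x e.1.1) * sg (x e.1.2) - ∑ e : VPair n,
        (if e.1.1 ∈ D then 0 else sg (x e.1.1)) * (if e.1.2 ∈ D then 0 else sg (x e.1.2)) := by
    rw [← Finset.sum_sub_distrib]
    refine Finset.sum_congr rfl fun e _ => ?_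
    by_cases ha : e.1.1 ∈ D <;> by_cases hb : e.1.2 ∈ D <;> simp [Touch, spin, ha, hb]
  rw [h3] at h1
  rw [h4] at h2
  change sOut D x ^ 2 = _ at h2
  rw [sum_sg_eq D x] at h1
  rw [h5]
  linarith

lemma card_touch_le {n : ℕ} (D : Finset (Fin n)) :
    (Finset.univ.filter fun e : VPair n => Touch (D : Set (Fin n)) e).card ≤ D.card * n := by
  have : D.card * n = (D ×ˢ (Finset.univ : Finset (Fin n))).card := by simp
  rw [this]
  refine Finset.card_le_card_of_injOn
    (fun e => if e.1.1 ∈ D then (e.1.1, e.1.2) else (e.1.2, e.1.1)) ?_ ?_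
  · intro e he
    have he : Touch (D : Set (Fin n)) e := by simpa using he
    by_cases h : e.1.1 ∈ D
    · simp [h]
    · have : e.1.2 ∈ D := by
        rcases he with he | he
        · exact absurd (by simpa using he) h
        · simpa using he
      simp [h, this]
  · intro e _ e' _ heq
    apply Subtype.ext
    have h1 := e.2
    have h2 := e'.2
    apply Prod.ext
    all_goals
      by_cases ha : e.1.1 ∈ D <;> by_cases hb : e'.1.1 ∈ D <;>
        simp only [ha, hb, if_true, if_false, Prod.mk.injEq] at heq <;> grind

lemma exp_le_one_sub {s : ℝ} (h : |s| ≤ 1 / 2) : Real.exp (-s - s ^ 2) ≤ 1 - s := by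
  have h1 := abs_le.mp h
  have h3 : 1 ≤ (1 - s) * Real.exp (s + s ^ 2) := by
    rcases le_total 0 s with hs | hs
    · have h3 := Real.quadratic_le_exp_of_nonneg (show 0 ≤ s + s ^ 2 by positivity)
      have h4 : 1 ≤ (1 - s) * (1 + (s + s ^ 2) + (s + s ^ 2) ^ 2 / 2) := by
        have : (1 - s) * (1 + (s + s ^ 2) + (s + s ^ 2) ^ 2 / 2) - 1 =
          s ^ 2 * ((1 - s ^ 2) * (1 + s) / 2 - s) := by ring
        have h5 : 0 ≤ (1 - s ^ 2) * (1 + s) / 2 - s := by nlinarith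
        nlinarith [mul_nonneg (sq_nonneg s) h5]
      exact h4.trans (mul_le_mul_of_nonneg_left h3 (by linarith))
    · have h3 := Real.add_one_le_exp (s + s ^ 2)
      have h4 : 1 ≤ (1 - s) * (s + s ^ 2 + 1) := by nlinarith [mul_nonneg (sq_nonneg s) (neg_nonneg.mpr hs)]
      exact h4.trans (mul_le_mul_of_nonneg_left h3 (by linarith))
  have h4 : Real.exp (-s - s ^ 2) = (Real.exp (s + s ^ 2))⁻¹ := by
    rw [← Real.exp_neg]; congr 1; ring
  rw [h4]
  rwa [inv_le_iff_one_le_mul₀ (Real.exp_pos _)]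

lemma abs_prod_sub_one_le {n K : ℕ} {L κ : ℝ} (hκ : |κ| ≤ 1 / 2) (D : Finset (Fin n))
    (g : VPair n → Bool) (x : Fin n → Fin 2) (hD : D.card ≤ K)
    (hg : (Finset.univ.filter fun e => rest D g e = true).card ≤ K ^ 2) (hL : |sOut D x| ≤ L) :
    |∏ e : VPair n, (if Touch (D : Set (Fin n)) e ∧ g e = false then 1 - κ * spin e x else 1) - 1|
      ≤ Real.exp (|κ| * (K * L + 2 * K ^ 2) + κ ^ 2 * (K * n)) - 1 := by
  set Q : VPair n → Prop := fun e => Touch (D : Set (Fin n)) e ∧ g e = false with hQ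
  have hDK : (D.card : ℝ) ≤ K := by exact_mod_cast hD
  have hL0 : 0 ≤ L := (abs_nonneg _).trans hL
  set T := ∑ e : VPair n, (if Q e then spin e x else 0) with hT
  have hsum : |T| ≤ K * L + 2 * K ^ 2 := by
    have h1 : T = ∑ e : VPair n, (if Touch (D : Set (Fin n)) e then spin e x else 0) -
        ∑ e ∈ Finset.univ.filter (fun e => rest D g e = true), spin e x := by
      rw [Finset.sum_filter, ← Finset.sum_sub_distrib]
      refine Finset.sum_congr rfl fun e _ => ?_
      by_cases ht : Touch (D : Set (Fin n)) e <;> by_cases hge : g e = true <;>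
        simp [hQ, rest, ht, hge]
    have h2 : |∑ e ∈ Finset.univ.filter (fun e => rest D g e = true), spin e x| ≤ K ^ 2 := by
      refine (Finset.abs_sum_le_sum_abs _ _).trans ?_
      simp only [abs_spin, Finset.sum_const, nsmul_eq_mul, mul_one]
      exact_mod_cast hg
    have h3 := sum_spin_touch D x
    have h4 := (abs_sum_sg_le D x).trans hDK
    set sD := ∑ i ∈ D, sg (x i)
    have h5 : |sD * sOut D x| ≤ K * L := by
      rw [abs_mul]
      exact mul_le_mul h4 hL (abs_nonneg _) (by positivity)
    have h6 : sD ^ 2 ≤ (K : ℝ) ^ 2 := sq_le_sq' (by linarith [(abs_le.mp h4).1]) (abs_le.mp h4).2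
    have h7 : (K : ℝ) ≤ K ^ 2 := by
      have : K ≤ K ^ 2 := Nat.le_self_pow (by norm_num) K
      exact_mod_cast this
    have h8 := abs_le.mp h5
    have h9 := abs_le.mp h2
    have h10 := sq_nonneg sD
    have h11 : (0 : ℝ) ≤ D.card := Nat.cast_nonneg _
    rw [h1, abs_le]
    constructor <;> nlinarith
  have hcard : ((Finset.univ.filter Q).card : ℝ) ≤ K * n := by
    have h1 : (Finset.univ.filter Q).card ≤ D.card * n :=
      (Finset.card_le_card (Finset.monotone_filter_right _ fun e _ he => he.1)).trans
        (card_touch_le D)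
    have h2 : ((Finset.univ.filter Q).card : ℝ) ≤ D.card * n := by exact_mod_cast h1
    exact h2.trans (mul_le_mul_of_nonneg_right hDK (Nat.cast_nonneg n))
  have hs : ∀ e : VPair n, |κ * spin e x| ≤ 1 / 2 := by
    intro e; rw [abs_mul, abs_spin, mul_one]; exact hκ
  have hs2 : ∀ e : VPair n, (κ * spin e x) ^ 2 = κ ^ 2 := by
    intro e; rw [mul_pow, ← sq_abs (spin e x), abs_spin]; ring
  have hpos : ∀ e : VPair n, 0 ≤ 1 - κ * spin e x := by
    intro e; linarith [(abs_le.mp (hs e)).2]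
  have hκs : |κ * T| ≤ |κ| * (K * L + 2 * K ^ 2) := by
    rw [abs_mul]; exact mul_le_mul_of_nonneg_left hsum (abs_nonneg _)
  set P := ∏ e : VPair n, (if Q e then 1 - κ * spin e x else 1) with hP
  have hup : P ≤ Real.exp (-(κ * T)) := by
    have : Real.exp (-(κ * T)) = ∏ e : VPair n, (if Q e then Real.exp (-(κ * spin e x)) else 1) := by
      rw [hT, Finset.mul_sum, ← Finset.sum_neg_distrib, Real.exp_sum]
      refine Finset.prod_congr rfl fun e _ => ?_
      split_ifs <;> simp
    rw [this]
    refine Finset.prod_le_prod (fun e _ => ?_) fun e _ => ?_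
    · split_ifs
      · exact hpos e
      · norm_num
    · split_ifs
      · have := Real.add_one_le_exp (-(κ * spin e x)); linarith
      · exact le_rfl
  have hlo : Real.exp (-(κ * T) - κ ^ 2 * (Finset.univ.filter Q).card) ≤ P := by
    have : Real.exp (-(κ * T) - κ ^ 2 * (Finset.univ.filter Q).card) =
        ∏ e : VPair n, (if Q e then Real.exp (-(κ * spin e x) - (κ * spin e x) ^ 2) else 1) := by
      have h1 : ((Finset.univ.filter Q).card : ℝ) = ∑ e : VPair n, if Q e then (1 : ℝ) else 0 :=
        (Finset.sum_boole _ _).symm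
      rw [hT, h1, Finset.mul_sum, Finset.mul_sum, ← Finset.sum_neg_distrib,
        ← Finset.sum_sub_distrib, Real.exp_sum]
      refine Finset.prod_congr rfl fun e _ => ?_
      rw [hs2]
      split_ifs <;> simp
    rw [this]
    refine Finset.prod_le_prod (fun e _ => ?_) fun e _ => ?_
    · split_ifs
      · exact (Real.exp_pos _).le
      · norm_num
    · split_ifs
      · exact exp_le_one_sub (hs e)
      · exact le_rfl
  set τ := |κ| * (K * L + 2 * K ^ 2) + κ ^ 2 * (K * n) with hτ
  have hB : κ ^ 2 * (Finset.univ.filter Q).card ≤ κ ^ 2 * (K * n) :=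
    mul_le_mul_of_nonneg_left hcard (sq_nonneg κ)
  have hB0 : 0 ≤ κ ^ 2 * (K * n : ℝ) := by positivity
  have h1 := abs_le.mp hκs
  have hup2 : P ≤ Real.exp τ := hup.trans (Real.exp_le_exp.mpr (by linarith))
  have hlo2 : Real.exp (-τ) ≤ P := le_trans (Real.exp_le_exp.mpr (by linarith)) hlo
  have h3 : 1 - Real.exp (-τ) ≤ Real.exp τ - 1 := by
    have := Real.add_one_le_exp τ
    have := Real.add_one_le_exp (-τ)
    linarith
  rw [abs_le]
  constructor <;> linarith

/-- Edge probabilities of the two-community model with mean density `q` and signal `θ`. -/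
noncomputable def pe {n : ℕ} (q θ : ℝ) (x : Fin n → Fin 2) : VPair n → ℝ :=
  fun e => q * (1 + θ * spin e x)

lemma abs_mul_spin_le {n : ℕ} {θ : ℝ} (hθ : |θ| ≤ 1) (e : VPair n) (x : Fin n → Fin 2) :
    |θ * spin e x| ≤ 1 := by
  rw [abs_mul, abs_spin, mul_one]; exact hθ

lemma pe_nonneg {n : ℕ} {q θ : ℝ} (hq : 0 ≤ q) (hθ : |θ| ≤ 1) (x : Fin n → Fin 2) (e : VPair n) :
    0 ≤ pe q θ x e :=
  mul_nonneg hq (by linarith [(abs_le.mp (abs_mul_spin_le hθ e x)).1])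

lemma pe_le {n : ℕ} {q θ : ℝ} (hq : 0 ≤ q) (hθ : |θ| ≤ 1) (x : Fin n → Fin 2) (e : VPair n) :
    pe q θ x e ≤ 2 * q := by
  have := (abs_le.mp (abs_mul_spin_le hθ e x)).2
  unfold pe
  nlinarith

lemma EX_abs_num_le {n : ℕ} (D : Finset (Fin n)) (u : Fin n) {t : VPair n → ℝ}
    (ht : ∀ e, |t e| ≤ 1) (h : ∀ e, t e ≠ 0 → ∃ C, IsCut t e C) :
    EX unif (fun x => |num D u t x|) ≤ √(mag D u t) := by
  have hw : ∀ x : Fin n → Fin 2, 0 ≤ ∏ i, unif i (x i) :=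
    fun x => Finset.prod_nonneg fun i _ => unif_nonneg i _
  have h1 : EX unif (den D t) = 1 := (EX_av D _).trans (EX_wt_eq_one t h)
  refine Real.le_sqrt_of_sq_le ?_
  have h2 : EX unif (fun x => |num D u t x|) ^ 2 ≤ mag D u t * EX unif (den D t) := by
    unfold mag EX
    refine Finset.sum_sq_le_sum_mul_sum_of_sq_le_mul _
      (fun x _ => mul_nonneg (hw x) (div_nonneg (sq_nonneg _) (den_nonneg D ht x)))
      (fun x _ => mul_nonneg (hw x) (den_nonneg D ht x)) fun x _ => le_of_eq ?_
    rcases eq_or_ne (den D t x) 0 with h0 | h0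
    · have h2 := abs_num_le D u ht x
      rw [h0] at h2
      have h3 : num D u t x = 0 := abs_nonpos_iff.mp h2
      simp [h0, h3]
    · rw [mul_pow, sq_abs]
      field_simp
  rwa [h1, mul_one] at h2

lemma prod_touch_eq {n : ℕ} {q θ : ℝ} (hq : q < 1) (D : Finset (Fin n)) (g : VPair n → Bool)
    (x : Fin n → Fin 2) :
    ∏ e, (if Touch (D : Set (Fin n)) e then bw (pe q θ x) e (g e) else 1) =
      (∏ e, if Touch (D : Set (Fin n)) e then bw (fun _ => q) e (g e) else 1) *
        (wt (fun e => if rest D g e then θ else 0) x *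
          ∏ e : VPair n, (if Touch (D : Set (Fin n)) e ∧ g e = false then
            1 - θ * q / (1 - q) * spin e x else 1)) := by
  unfold wt
  rw [← Finset.prod_mul_distrib, ← Finset.prod_mul_distrib]
  refine Finset.prod_congr rfl fun e _ => ?_
  have : 1 - q ≠ 0 := by linarith
  by_cases ht : Touch (D : Set (Fin n)) e <;> by_cases hg : g e = true
  · simp [ht, hg, rest, bw, pe]
  · simp only [ht, rest, bw, pe, hg]
    simp
    field_simp
    ring
  · simp [ht, rest]
  · simp [ht, rest]

/-- The ball of radius `r + 1` around `u` is small and its open pairs form a forest. -/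
def Good {n : ℕ} (K : ℕ) (u : Fin n) (r : ℕ) (g : VPair n → Bool) : Prop :=
  (ball g u (r + 1)).card ≤ K ∧ Forest (rest (ball g u r) g)

/-- Relative error from the pairs that are not open. -/
noncomputable def clErr (n K : ℕ) (L q θ : ℝ) : ℝ :=
  Real.exp (|θ * q / (1 - q)| * (K * L + 2 * K ^ 2) + (θ * q / (1 - q)) ^ 2 * (K * n)) - 1

lemma abs_av_le {n K : ℕ} {L q θ : ℝ} (hq : 0 ≤ q) (hq4 : q ≤ 1 / 4) (hθ : |θ| ≤ 1) (u : Fin n)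
    (r : ℕ) (g : VPair n → Bool) (hg : Good K u r g) (x : Fin n → Fin 2)
    (hL : |sOut (ball g u r) x| ≤ L) :
    |av (ball g u r) (fun y => (∏ e, (if Touch (ball g u r : Set (Fin n)) e then
      bw (pe q θ y) e (g e) else 1)) * sg (y u)) x| ≤
      (∏ e, if Touch (ball g u r : Set (Fin n)) e then bw (fun _ => q) e (g e) else 1) *
        (|num (ball g u r) u (fun e => if rest (ball g u r) g e then θ else 0) x| +
          clErr n K L q θ * den (ball g u r) (fun e => if rest (ball g u r) g e then θ else 0) x) := by
  set D := ball g u r with hD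
  set t : VPair n → ℝ := fun e => if rest D g e then θ else 0 with ht
  have ht1 : ∀ e, |t e| ≤ 1 := by intro e; simp only [ht]; split_ifs <;> simp [hθ]
  set c := ∏ e, if Touch (D : Set (Fin n)) e then bw (fun _ => q) e (g e) else 1 with hc
  have hc0 : 0 ≤ c := by
    refine Finset.prod_nonneg fun e _ => ?_
    split_ifs
    · exact bw_nonneg (p := fun _ : VPair n => q) (fun _ => hq) (fun _ => by linarith) e _
    · norm_num
  set ρ : (Fin n → Fin 2) → ℝ := fun y => ∏ e : VPair n,
    (if Touch (D : Set (Fin n)) e ∧ g e = false then 1 - θ * q / (1 - q) * spin e y else 1) with hρ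
  have hκ : |θ * q / (1 - q)| ≤ 1 / 2 := by
    rw [abs_div, abs_mul, abs_of_nonneg hq, abs_of_pos (by linarith : 0 < 1 - q),
      div_le_iff₀ (by linarith)]
    nlinarith [abs_nonneg θ]
  have hDK : D.card ≤ K := (Finset.card_le_card (ball_subset_succ g u r)).trans hg.1
  have hrest : (Finset.univ.filter fun e => rest D g e = true).card ≤ K ^ 2 := by
    refine le_trans (Finset.card_le_card fun e he => ?_)
      ((card_pairsIn_le (ball g u (r + 1))).trans (Nat.pow_le_pow_left hg.1 2))
    exact (Finset.mem_filter.mp (rest_subset g u r e (Finset.mem_filter.mp he).2)).1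
  have hρ1 : ∀ y, (∀ i ∉ D, y i = x i) → |ρ y - 1| ≤ clErr n K L q θ := by
    intro y hy
    refine abs_prod_sub_one_le hκ D g y hDK hrest ?_
    have : sOut D y = sOut D x := by
      refine Finset.sum_congr rfl fun i _ => ?_
      split_ifs with h
      · rfl
      · rw [hy i h]
    rw [this]
    exact hL
  have heq : ∀ y, (∏ e, (if Touch (D : Set (Fin n)) e then bw (pe q θ y) e (g e) else 1)) *
      sg (y u) = c * (wt t y * sg (y u) + wt t y * (ρ y - 1) * sg (y u)) := by
    intro y
    rw [prod_touch_eq (by linarith)]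
    ring
  have h1 : av D (fun y => (∏ e, (if Touch (D : Set (Fin n)) e then
      bw (pe q θ y) e (g e) else 1)) * sg (y u)) x =
      c * (num D u t x + av D (fun y => wt t y * (ρ y - 1) * sg (y u)) x) := by
    simp only [heq]
    unfold num av
    rw [EX_const_mul, EX_add]
  have h2 : |av D (fun y => wt t y * (ρ y - 1) * sg (y u)) x| ≤ clErr n K L q θ * den D t x := by
    refine (EX_abs_le unif_nonneg _).trans ?_
    unfold den av
    rw [← EX_const_mul]
    refine EX_mono unif_nonneg fun y => ?_
    rw [abs_mul, abs_sg, mul_one, abs_mul, abs_of_nonneg (wt_nonneg ht1 _), mul_comm]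
    refine mul_le_mul_of_nonneg_right (hρ1 _ fun i hi => ?_) (wt_nonneg ht1 _)
    simp [mix, hi]
  rw [h1, abs_mul, abs_of_nonneg hc0]
  refine mul_le_mul_of_nonneg_left ((abs_add_le _ _).trans (by linarith)) hc0

lemma clErr_nonneg {n K : ℕ} {L : ℝ} (hL : 0 ≤ L) (q θ : ℝ) : 0 ≤ clErr n K L q θ := by
  unfold clErr
  rw [sub_nonneg, Real.one_le_exp_iff]
  positivity

lemma rest_congr {n : ℕ} {g g' : VPair n → Bool} (D : Finset (Fin n))
    (h : ∀ e, Touch (D : Set (Fin n)) e → g e = g' e) : rest D g' = rest D g := by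
  funext e
  by_cases ht : Touch (D : Set (Fin n)) e
  · simp [rest, h e ht]
  · simp [rest, ht]

/-- Edge interactions of strength `θ` on the open pairs touching the ball. -/
noncomputable def tBall {n : ℕ} (θ : ℝ) (u : Fin n) (r : ℕ) (g : VPair n → Bool) : VPair n → ℝ :=
  fun e => if rest (ball g u r) g e then θ else 0

/-- Bound for the conditional mean of the spin at `u`. -/
noncomputable def corrBound {n : ℕ} (K : ℕ) (L q θ : ℝ) (u : Fin n) (r : ℕ)
    (x : Fin n → Fin 2) (g : VPair n → Bool) : ℝ :=
  if Good K u r g then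
    |num (ball g u r) u (tBall θ u r g) x| +
      clErr n K L q θ * den (ball g u r) (tBall θ u r g) x
  else 0

/-- The pairs touching the ball of radius `r`. -/
def touchSet {n : ℕ} (u : Fin n) (r : ℕ) (g : VPair n → Bool) : Set (VPair n) :=
  {e | Touch (ball g u r : Set (Fin n)) e}

lemma abs_tBall_le {n : ℕ} {θ : ℝ} (hθ : |θ| ≤ 1) (u : Fin n) (r : ℕ) (g : VPair n → Bool)
    (e : VPair n) : |tBall θ u r g e| ≤ 1 := by
  unfold tBall; split_ifs <;> simp [hθ]

lemma tBall_isCut {n K : ℕ} {θ : ℝ} {u : Fin n} {r : ℕ} {g : VPair n → Bool} (hg : Good K u r g)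
    (e : VPair n) (he : tBall θ u r g e ≠ 0) : ∃ C, IsCut (tBall θ u r g) e C := by
  have h1 : ∀ e, tBall θ u r g e ≠ 0 → rest (ball g u r) g e = true := by
    intro e he
    by_contra h
    simp [tBall, h] at he
  exact hg.2.isCut _ h1 e (h1 e he)

lemma corrBound_nonneg {n K : ℕ} {L θ : ℝ} (hL : 0 ≤ L) (q : ℝ) (hθ : |θ| ≤ 1) (u : Fin n) (r : ℕ)
    (x : Fin n → Fin 2) (g : VPair n → Bool) : 0 ≤ corrBound K L q θ u r x g := by
  unfold corrBound
  split_ifs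
  · exact add_nonneg (abs_nonneg _)
      (mul_nonneg (clErr_nonneg hL q θ) (den_nonneg _ (abs_tBall_le hθ u r g) x))
  · exact le_rfl

lemma abs_EX_graph_le {n K : ℕ} {L q θ : ℝ} (hL : 0 ≤ L) (hq : 0 ≤ q) (hq4 : q ≤ 1 / 4)
    (hθ : |θ| ≤ 1) (u : Fin n) (r : ℕ) (F : (Fin n → Fin 2) → (VPair n → Bool) → ℝ)
    (hF1 : ∀ x g, |F x g| ≤ 1)
    (hF : ∀ g x y, (∀ i ∉ ball g u r, y i = x i) → F y g = F x g)
    (hFs : ∀ x g, F x g ≠ 0 → Good K u r g ∧ |sOut (ball g u r) x| ≤ L) (g : VPair n → Bool) :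
    |EX unif (fun x => (∏ e, bw (pe q θ x) e (g e)) * (sg (x u) * F x g))| ≤
      EX unif (fun x => (∏ e, mix (· ∈ touchSet u r g) (bw fun _ => q) (bw (pe q θ x)) e (g e)) *
        corrBound K L q θ u r x g) := by
  have hbq := bw_nonneg (p := fun _ : VPair n => q) (fun _ => hq) (fun _ => by linarith)
  have hbx : ∀ x : Fin n → Fin 2, ∀ e b, 0 ≤ bw (pe q θ x) e b := fun x =>
    bw_nonneg (pe_nonneg hq hθ x) (fun e => (pe_le hq hθ x e).trans (by linarith))
  set D := ball g u r with hD
  set A : (Fin n → Fin 2) → ℝ := fun x =>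
    ∏ e, (if Touch (D : Set (Fin n)) e then bw (pe q θ x) e (g e) else 1) with hA
  set B : (Fin n → Fin 2) → ℝ := fun x =>
    ∏ e, (if Touch (D : Set (Fin n)) e then 1 else bw (pe q θ x) e (g e)) with hB
  set c := ∏ e, if Touch (D : Set (Fin n)) e then bw (fun _ => q) e (g e) else 1 with hc
  have hB0 : ∀ x, 0 ≤ B x := by
    intro x
    refine Finset.prod_nonneg fun e _ => ?_
    split_ifs
    · norm_num
    · exact hbx x e _
  have hAB : ∀ x, (∏ e, bw (pe q θ x) e (g e)) * (sg (x u) * F x g) =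
      (B x * F x g) * (A x * sg (x u)) := by
    intro x
    have : ∏ e, bw (pe q θ x) e (g e) = A x * B x := by
      simp only [hA, hB]
      rw [← Finset.prod_mul_distrib]
      refine Finset.prod_congr rfl fun e _ => ?_
      split_ifs <;> simp
    rw [this]
    ring
  have hmix : ∀ x, ∏ e, mix (· ∈ touchSet u r g) (bw fun _ => q) (bw (pe q θ x)) e (g e) =
      c * B x := by
    intro x
    simp only [hc, hB]
    rw [← Finset.prod_mul_distrib]
    refine Finset.prod_congr rfl fun e _ => ?_
    by_cases ht : Touch (D : Set (Fin n)) e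
    · have : e ∈ touchSet u r g := ht
      simp [mix, this, ht]
    · have : e ∉ touchSet u r g := ht
      simp [mix, this, ht]
  have hoff : ∀ x y, (∀ i ∉ D, y i = x i) → B y * F y g = B x * F x g := by
    intro x y h
    rw [hF g x y h]
    congr 1
    refine Finset.prod_congr rfl fun e _ => ?_
    split_ifs with hte
    · rfl
    · have h1 : y e.1.1 = x e.1.1 := h _ fun hm => hte (Or.inl hm)
      have h2 : y e.1.2 = x e.1.2 := h _ fun hm => hte (Or.inr hm)
      simp [bw, pe, spin, h1, h2]
  simp only [hAB, hmix]
  rw [← EX_av D]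
  refine (EX_abs_le unif_nonneg _).trans (EX_mono unif_nonneg fun x => ?_)
  rw [av_mul_of_off D (fun x => A x * sg (x u)) (fun x => B x * F x g) hoff, abs_mul, abs_mul,
    abs_of_nonneg (hB0 x)]
  by_cases h0 : F x g = 0
  · have hc0 : 0 ≤ c := by
      refine Finset.prod_nonneg fun e _ => ?_
      split_ifs
      · exact hbq e _
      · norm_num
    rw [h0, abs_zero, mul_zero, zero_mul]
    exact mul_nonneg (mul_nonneg hc0 (hB0 x)) (corrBound_nonneg hL q hθ u r x g)
  · obtain ⟨hgood, hs⟩ := hFs x g h0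
    have h1 := abs_av_le hq hq4 hθ u r g hgood x hs
    rw [corrBound, if_pos hgood]
    calc B x * |F x g| * |av D (fun x => A x * sg (x u)) x|
        ≤ B x * 1 * (c * (|num D u (tBall θ u r g) x| +
            clErr n K L q θ * den D (tBall θ u r g) x)) := by
          refine mul_le_mul (mul_le_mul_of_nonneg_left (hF1 x g) (hB0 x)) h1 (abs_nonneg _) ?_
          simpa using hB0 x
      _ = _ := by ring

lemma sum_mix_corrBound {n : ℕ} (K : ℕ) (L q θ : ℝ) (u : Fin n) (r : ℕ) (x : Fin n → Fin 2) :
    ∑ g : VPair n → Bool,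
      (∏ e, mix (· ∈ touchSet u r g) (bw fun _ => q) (bw (pe q θ x)) e (g e)) *
        corrBound K L q θ u r x g = EX (bw fun _ => q) (corrBound K L q θ u r x) := by
  have hS : ∀ g g' : VPair n → Bool, (∀ e ∈ touchSet u r g, g e = g' e) →
      touchSet u r g' = touchSet u r g := by
    intro g g' h
    unfold touchSet
    rw [ball_congr h r (by omega)]
  have hC : ∀ g g' : VPair n → Bool, (∀ e ∈ touchSet u r g, g e = g' e) →
      corrBound K L q θ u r x g' = corrBound K L q θ u r x g := by
    intro g g' h
    have hr := ball_congr h r (by omega)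
    have hr1 := ball_congr h (r + 1) le_rfl
    have hre : rest (ball g' u r) g' = rest (ball g u r) g := by
      rw [hr]; exact rest_congr _ h
    unfold corrBound tBall Good
    rw [hre, hr, hr1]
  have := sum_stopping (bw_sum fun _ : VPair n => q) (bw_sum (pe q θ x)) (touchSet u r) hS
    (corrBound K L q θ u r x) hC
  convert this

lemma EX_corrBound_le {n K : ℕ} {L θ : ℝ} (hL : 0 ≤ L) (q : ℝ) (hθ : |θ| ≤ 1) (u : Fin n) (r : ℕ)
    (g : VPair n → Bool) :
    EX unif (fun x => corrBound K L q θ u r x g) ≤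
      (if Good K u r g then √(mag (ball g u r) u (tBall θ u r g)) else 0) + clErr n K L q θ := by
  by_cases hg : Good K u r g
  · simp only [corrBound, if_pos hg]
    rw [EX_add, EX_const_mul]
    have h1 := EX_abs_num_le (ball g u r) u (abs_tBall_le hθ u r g) (tBall_isCut hg)
    have h2 : EX unif (fun x => den (ball g u r) (tBall θ u r g) x) = 1 :=
      (EX_av _ _).trans (EX_wt_eq_one _ (tBall_isCut hg))
    rw [h2]
    linarith
  · simp only [corrBound, if_neg hg, EX_const unif_sum]
    linarith [clErr_nonneg (n := n) (K := K) hL q θ]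

lemma EX_sqrt_mag_le {n K : ℕ} {q θ : ℝ} (hq : 0 ≤ q) (hq1 : q ≤ 1) (hθ : |θ| ≤ 1) (u : Fin n)
    (r : ℕ) :
    EX (bw fun _ : VPair n => q)
      (fun g => if Good K u r g then √(mag (ball g u r) u (tBall θ u r g)) else 0) ≤
      √(EX (bw fun _ : VPair n => q * θ ^ 2) (fun g => if SAW g (r + 1) u ∅ then 1 else 0)) := by
  have hθ2 : θ ^ 2 ≤ 1 := by rw [← sq_abs]; nlinarith [abs_nonneg θ]
  have hbq := bw_nonneg (p := fun _ : VPair n => q) (fun _ => hq) (fun _ => hq1)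
  refine Real.le_sqrt_of_sq_le ((EX_sq_le (bw_sum _) hbq _).trans ?_)
  rw [← EX_and (fun _ => q) (fun _ => θ ^ 2)]
  refine EX_mono hbq fun g => ?_
  by_cases hg : Good K u r g
  · have hmag0 : 0 ≤ mag (ball g u r) u (tBall θ u r g) :=
      EX_nonneg unif_nonneg fun x =>
        div_nonneg (sq_nonneg _) (den_nonneg _ (abs_tBall_le hθ u r g) x)
    rw [if_pos hg, Real.sq_sqrt hmag0]
    refine (mag_le_percolation (ball g u r) u hg.2 hθ).trans ?_
    refine EX_mono (bw_nonneg (fun _ => sq_nonneg θ) fun _ => hθ2) fun ω => ?_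
    exact mag_open_le g ω u r hg.2
  · rw [if_neg hg]
    simp only [ne_eq, OfNat.ofNat_ne_zero, not_false_eq_true, zero_pow]
    refine EX_nonneg (bw_nonneg (fun _ => sq_nonneg θ) fun _ => hθ2) fun ω => ?_
    split_ifs <;> norm_num

/-- A function of the labels far from `u` is almost uncorrelated with the label of `u`. -/
lemma abs_corr_le {n K : ℕ} {L q θ : ℝ} (hL : 0 ≤ L) (hq : 0 ≤ q) (hq4 : q ≤ 1 / 4)
    (hθ : |θ| ≤ 1) (u : Fin n) (r : ℕ) (F : (Fin n → Fin 2) → (VPair n → Bool) → ℝ)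
    (hF1 : ∀ x g, |F x g| ≤ 1)
    (hF : ∀ g x y, (∀ i ∉ ball g u r, y i = x i) → F y g = F x g)
    (hFs : ∀ x g, F x g ≠ 0 → Good K u r g ∧ |sOut (ball g u r) x| ≤ L) :
    |EX unif (fun x => EX (bw (pe q θ x)) (fun g => sg (x u) * F x g))| ≤
      clErr n K L q θ +
        √(EX (bw fun _ : VPair n => q * θ ^ 2) (fun g => if SAW g (r + 1) u ∅ then 1 else 0)) := by
  have hbq := bw_nonneg (p := fun _ : VPair n => q) (fun _ => hq) (fun _ => by linarith)
  have h1 : EX unif (fun x => EX (bw (pe q θ x)) (fun g => sg (x u) * F x g)) =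
      ∑ g : VPair n → Bool,
        EX unif (fun x => (∏ e, bw (pe q θ x) e (g e)) * (sg (x u) * F x g)) := by
    rw [← EX_sum]
    refine congrArg (EX unif) (funext fun x => ?_)
    rw [EX]
    congr!
  have h2 : ∑ g : VPair n → Bool, EX unif (fun x =>
        (∏ e, mix (· ∈ touchSet u r g) (bw fun _ => q) (bw (pe q θ x)) e (g e)) *
          corrBound K L q θ u r x g) =
      EX (bw fun _ : VPair n => q) (fun g => EX unif (fun x => corrBound K L q θ u r x g)) := by
    rw [← EX_sum, EX_comm]
    simp only [sum_mix_corrBound]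
  have h3 : EX (bw fun _ : VPair n => q) (fun g => EX unif (fun x => corrBound K L q θ u r x g)) ≤
      EX (bw fun _ : VPair n => q) (fun g =>
        (if Good K u r g then √(mag (ball g u r) u (tBall θ u r g)) else 0) + clErr n K L q θ) :=
    EX_mono hbq fun g => EX_corrBound_le hL q hθ u r g
  rw [EX_add, EX_const (bw_sum _)] at h3
  have h4 := EX_sqrt_mag_le (K := K) hq (by linarith) hθ u r
  rw [h1]
  refine (Finset.abs_sum_le_sum_abs _ _).trans
    ((Finset.sum_le_sum fun g _ => abs_EX_graph_le hL hq hq4 hθ u r F hF1 hF hFs g).trans ?_)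
  rw [h2]
  linarith

/-- Joint expectation over the labels and the graph. -/
noncomputable def jointEX {n : ℕ} (q θ : ℝ) (H : (Fin n → Fin 2) → (VPair n → Bool) → ℝ) : ℝ :=
  EX unif (fun x => EX (bw (pe q θ x)) (H x))

lemma bw_pe_nonneg {n : ℕ} {q θ : ℝ} (hq : 0 ≤ q) (hq2 : q ≤ 1 / 2) (hθ : |θ| ≤ 1)
    (x : Fin n → Fin 2) (e : VPair n) (b : Bool) : 0 ≤ bw (pe q θ x) e b :=
  bw_nonneg (pe_nonneg hq hθ x) (fun e => (pe_le hq hθ x e).trans (by linarith)) e b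

lemma jointEX_mono {n : ℕ} {q θ : ℝ} (hq : 0 ≤ q) (hq2 : q ≤ 1 / 2) (hθ : |θ| ≤ 1)
    {H H' : (Fin n → Fin 2) → (VPair n → Bool) → ℝ} (h : ∀ x g, H x g ≤ H' x g) :
    jointEX q θ H ≤ jointEX q θ H' :=
  EX_mono unif_nonneg fun x => EX_mono (bw_pe_nonneg hq hq2 hθ x) (h x)

lemma jointEX_add {n : ℕ} (q θ : ℝ) (H H' : (Fin n → Fin 2) → (VPair n → Bool) → ℝ) :
    jointEX q θ (fun x g => H x g + H' x g) = jointEX q θ H + jointEX q θ H' := by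
  simp only [jointEX, EX_add]

lemma jointEX_const_mul {n : ℕ} (q θ c : ℝ) (H : (Fin n → Fin 2) → (VPair n → Bool) → ℝ) :
    jointEX q θ (fun x g => c * H x g) = c * jointEX q θ H := by
  simp only [jointEX, EX_const_mul]

lemma jointEX_sum {n : ℕ} {κ : Type*} (s : Finset κ) (q θ : ℝ)
    (H : κ → (Fin n → Fin 2) → (VPair n → Bool) → ℝ) :
    jointEX q θ (fun x g => ∑ k ∈ s, H k x g) = ∑ k ∈ s, jointEX q θ (H k) := by
  simp only [jointEX, EX_sum]

lemma EX_spin {n : ℕ} (e : VPair n) : EX unif (spin e) = 0 := by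
  have h1 := EX_flip {e.1.1} (spin e)
  have h2 : Crosses {e.1.1} e := by
    have : e.1.2 ≠ e.1.1 := e.2.ne'
    simp [Crosses, this]
  simp only [spin_flip, if_pos h2] at h1
  rw [EX_const_mul] at h1
  have h3 : EX unif (fun x => spin e x) = EX unif (spin e) := rfl
  linarith

lemma EX_sum_sg_sq (n : ℕ) : EX unif (fun x : Fin n → Fin 2 => (∑ i, sg (x i)) ^ 2) = n := by
  have h : ∀ x : Fin n → Fin 2, (∑ i, sg (x i)) ^ 2 = n + 2 * ∑ e : VPair n, spin e x := by
    intro x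
    rw [sq_sum_eq]
    simp [sg_sq, spin]
  simp only [h]
  rw [EX_add, EX_const unif_sum, EX_const_mul, EX_sum]
  have : ∀ e : VPair n, EX unif (fun x => spin e x) = 0 := EX_spin
  simp [this]

lemma EX_not_good_le {n K : ℕ} (hK : 0 < K) (hn : 0 < n) {p : VPair n → ℝ} {c : ℝ}
    (hp0 : ∀ e, 0 ≤ p e) (hp1 : ∀ e, p e ≤ 1) (hpc : ∀ e, p e ≤ c) (hc : 0 ≤ c) (u : Fin n)
    (r : ℕ) :
    EX (bw p) (fun g => if Good K u r g then 0 else 1) ≤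
      (∑ i ∈ Finset.range (r + 2), (n * c) ^ i) / K +
        (∑ t ∈ Finset.range (K + 1), (((K : ℝ) + 1) ^ 2 * (n * c)) ^ (t + 1)) / n := by
  have hK' : (0 : ℝ) < K := by exact_mod_cast hK
  have hn' : (0 : ℝ) < n := by exact_mod_cast hn
  have h1 := EX_card_ball_le hp0 hp1 hpc hc u (r + 1)
  have h2 := EX_excess_le hp0 hp1 hpc hc K u
  have h3 : EX (bw p) (fun g => if Good K u r g then (0 : ℝ) else 1) ≤
      EX (bw p) (fun g => (1 / K : ℝ) * ((ball g u (r + 1)).card : ℝ) +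
        if Excess K u g then 1 else 0) := by
    refine EX_mono (bw_nonneg hp0 hp1) fun g => ?_
    by_cases hg : Good K u r g
    · rw [if_pos hg]
      split_ifs <;> positivity
    · rw [if_neg hg]
      by_cases hc : (ball g u (r + 1)).card ≤ K
      · have hE : Excess K u g := by
          by_contra hE
          exact hg ⟨hc, forest_of_not_excess hc hE⟩
        rw [if_pos hE]
        have : (0 : ℝ) ≤ 1 / K * ((ball g u (r + 1)).card : ℝ) := by positivity
        linarith
      · have h4 : (K : ℝ) ≤ (ball g u (r + 1)).card := by exact_mod_cast (not_le.mp hc).le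
        have h5 : (1 : ℝ) ≤ 1 / K * ((ball g u (r + 1)).card : ℝ) := by
          rw [one_div, inv_mul_eq_div, le_div_iff₀ hK', one_mul]; exact h4
        split_ifs <;> linarith
  rw [EX_add, EX_const_mul] at h3
  refine h3.trans (add_le_add ?_ ?_)
  · rw [one_div, inv_mul_eq_div]
    exact div_le_div_of_nonneg_right h1 hK'.le
  · rw [le_div_iff₀ hn', mul_comm]
    exact h2

/-- Signed overlap of two labellings. -/
noncomputable def overlap {n : ℕ} (x y : Fin n → Fin 2) : ℝ := ∑ v, sg (x v) * sg (y v)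

/-- The part of the normalized overlap coming from labels far from `u`. -/
noncomputable def farOverlap {n : ℕ} (K : ℕ) (L : ℝ) (est : (VPair n → Bool) → (Fin n → Fin 2))
    (u : Fin n) (r : ℕ) (x : Fin n → Fin 2) (g : VPair n → Bool) : ℝ :=
  if Good K u r g ∧ |sOut (ball g u r) x| ≤ L then
    sg (est g u) * ((∑ v, if v ∈ ball g u r then 0 else sg (x v) * sg (est g v)) / n)
  else 0

lemma abs_sum_div_le_one {n : ℕ} {f : Fin n → ℝ} (hf : ∀ v, |f v| ≤ 1) : |(∑ v, f v) / n| ≤ 1 := by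
  rw [abs_div, Nat.abs_cast]
  refine div_le_one_of_le₀ ?_ (Nat.cast_nonneg n)
  refine (Finset.abs_sum_le_sum_abs _ _).trans ((Finset.sum_le_sum fun v _ => hf v).trans ?_)
  simp

lemma abs_farOverlap_le {n : ℕ} (K : ℕ) (L : ℝ) (est : (VPair n → Bool) → (Fin n → Fin 2))
    (u : Fin n) (r : ℕ) (x : Fin n → Fin 2) (g : VPair n → Bool) :
    |farOverlap K L est u r x g| ≤ 1 := by
  unfold farOverlap
  split_ifs
  · rw [abs_mul, abs_sg, one_mul]
    refine abs_sum_div_le_one fun v => ?_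
    split_ifs <;> simp [abs_mul, abs_sg]
  · simp

lemma farOverlap_congr {n : ℕ} (K : ℕ) (L : ℝ) (est : (VPair n → Bool) → (Fin n → Fin 2))
    (u : Fin n) (r : ℕ) (g : VPair n → Bool) (x y : Fin n → Fin 2)
    (h : ∀ i ∉ ball g u r, y i = x i) :
    farOverlap K L est u r y g = farOverlap K L est u r x g := by
  have h1 : sOut (ball g u r) y = sOut (ball g u r) x := by
    refine Finset.sum_congr rfl fun i _ => ?_
    split_ifs with hi
    · rfl
    · rw [h i hi]
  have h2 : (∑ v, if v ∈ ball g u r then 0 else sg (y v) * sg (est g v)) =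
      ∑ v, if v ∈ ball g u r then 0 else sg (x v) * sg (est g v) := by
    refine Finset.sum_congr rfl fun i _ => ?_
    split_ifs with hi
    · rfl
    · rw [h i hi]
  unfold farOverlap
  rw [h1, h2]

lemma overlap_term_le {n K : ℕ} {L : ℝ} (hL : (K : ℝ) < L)
    (est : (VPair n → Bool) → (Fin n → Fin 2)) (u : Fin n) (r : ℕ) (x : Fin n → Fin 2)
    (g : VPair n → Bool) :
    sg (x u) * (sg (est g u) * (overlap x (est g) / n)) ≤
      sg (x u) * farOverlap K L est u r x g +
        ((K / n : ℝ) + (if Good K u r g then 0 else 1) + 1 / (L - K) ^ 2 * (∑ i, sg (x i)) ^ 2) := by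
  have hLK : 0 < (L - K) ^ 2 := by have : 0 < L - K := by linarith
                                   positivity
  have h0 : 0 ≤ 1 / (L - K) ^ 2 * (∑ i, sg (x i)) ^ 2 := by positivity
  have hKn : (0 : ℝ) ≤ K / n := by positivity
  by_cases hs : Good K u r g ∧ |sOut (ball g u r) x| ≤ L
  · rw [farOverlap, if_pos hs, if_pos hs.1]
    have hcard : ((ball g u r).card : ℝ) ≤ K := by
      exact_mod_cast (Finset.card_le_card (ball_subset_succ g u r)).trans hs.1.1
    have hsplit : overlap x (est g) = ∑ v ∈ ball g u r, sg (x v) * sg (est g v) +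
        ∑ v, if v ∈ ball g u r then 0 else sg (x v) * sg (est g v) := by
      unfold overlap
      rw [← Finset.sum_filter_add_sum_filter_not Finset.univ (· ∈ ball g u r)]
      congr 1
      · simp
      · rw [Finset.sum_filter]
        exact Finset.sum_congr rfl fun i _ => by by_cases h : i ∈ ball g u r <;> simp [h]
    have hD : |∑ v ∈ ball g u r, sg (x v) * sg (est g v)| ≤ K := by
      refine (Finset.abs_sum_le_sum_abs _ _).trans ?_
      simp only [abs_mul, abs_sg, mul_one, Finset.sum_const, nsmul_eq_mul]
      exact hcard
    have h1 : sg (x u) * (sg (est g u) *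
        ((∑ v ∈ ball g u r, sg (x v) * sg (est g v)) / n)) ≤ K / n := by
      refine (le_abs_self _).trans ?_
      rw [abs_mul, abs_mul, abs_sg, abs_sg, one_mul, one_mul, abs_div, Nat.abs_cast]
      exact div_le_div_of_nonneg_right hD (Nat.cast_nonneg n)
    rw [hsplit, add_div, mul_add, mul_add]
    linarith
  · rw [farOverlap, if_neg hs, mul_zero, zero_add]
    have h1 : sg (x u) * (sg (est g u) * (overlap x (est g) / n)) ≤ 1 := by
      refine (le_abs_self _).trans ?_
      rw [abs_mul, abs_mul, abs_sg, abs_sg, one_mul, one_mul]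
      exact abs_sum_div_le_one fun v => by simp [abs_mul, abs_sg]
    by_cases hg : Good K u r g
    · rw [if_pos hg]
      have h2 : L < |sOut (ball g u r) x| := by
        by_contra h
        exact hs ⟨hg, not_lt.mp h⟩
      have hcard : ((ball g u r).card : ℝ) ≤ K := by
        exact_mod_cast (Finset.card_le_card (ball_subset_succ g u r)).trans hg.1
      have h3 := (abs_sum_sg_le (ball g u r) x).trans hcard
      have h4 : L - K ≤ |∑ i, sg (x i)| := by
        have h5 := abs_sub (∑ i, sg (x i)) (∑ i ∈ ball g u r, sg (x i))
        have h6 : ∑ i, sg (x i) - ∑ i ∈ ball g u r, sg (x i) = sOut (ball g u r) x := by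
          rw [sum_sg_eq (ball g u r) x]; ring
        rw [h6] at h5
        linarith
      have h5 : (L - K) ^ 2 ≤ (∑ i, sg (x i)) ^ 2 := by
        rw [← sq_abs (∑ i, sg (x i))]
        exact pow_le_pow_left₀ (by linarith) h4 2
      have h6 : 1 ≤ 1 / (L - K) ^ 2 * (∑ i, sg (x i)) ^ 2 := by
        rw [one_div, inv_mul_eq_div, le_div_iff₀ hLK, one_mul]; exact h5
      linarith
    · rw [if_neg hg]
      linarith

/-- Upper bound for the second moment of the normalized overlap. -/
noncomputable def overlapBound (n K r : ℕ) (L q θ : ℝ) : ℝ :=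
  clErr n K L q θ + √(surv 1 (r + 1) + (r + 1) / n) +
    (K / n + ((∑ i ∈ Finset.range (r + 2), (n * (2 * q)) ^ i) / K +
      (∑ t ∈ Finset.range (K + 1), (((K : ℝ) + 1) ^ 2 * (n * (2 * q))) ^ (t + 1)) / n) +
      1 / (L - K) ^ 2 * n)

lemma EX_SAW_le_surv_one {n : ℕ} (hn : 0 < n) {p : ℝ} (hp : 0 ≤ p) (hpn : n * p ≤ 1)
    (hp2 : p ≤ 1 / 2) (r : ℕ) (u : Fin n) :
    EX (bw fun _ : VPair n => p) (fun g => if SAW g r u ∅ then 1 else 0) ≤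
      surv 1 r + r / n := by
  have hn' : (0 : ℝ) < n := by exact_mod_cast hn
  have hexp := exp_le_one_sub (s := p) (by rw [abs_of_nonneg hp]; exact hp2)
  have h1 := EX_SAW_le (n := n) (c := p + p ^ 2) hp (by linarith)
    (by rw [neg_add, ← sub_eq_add_neg]; exact hexp) (by positivity) r u ∅
  have hm : (n : ℝ) * (p + p ^ 2) ≤ 1 + 1 / n := by
    have h2 : n * p ^ 2 ≤ 1 / n := by
      rw [le_div_iff₀ hn']
      nlinarith [mul_nonneg hn'.le hp]
    linarith
  have h2 := surv_le_surv_add (by positivity) (by positivity) hm r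
  refine h1.trans (h2.trans (le_of_eq ?_))
  ring

lemma jointEX_overlap_le {n K : ℕ} (hn : 0 < n) (hK : 0 < K) {L q θ : ℝ} (hL : (K : ℝ) < L)
    (hq : 0 ≤ q) (hq4 : q ≤ 1 / 4) (hθ : |θ| ≤ 1) (hKS : n * (q * θ ^ 2) ≤ 1)
    (est : (VPair n → Bool) → (Fin n → Fin 2)) (r : ℕ) :
    jointEX q θ (fun x g => (overlap x (est g) / n) ^ 2) ≤ overlapBound n K r L q θ := by
  have hn' : (0 : ℝ) < n := by exact_mod_cast hn
  have hθ2 : θ ^ 2 ≤ 1 := by rw [← sq_abs]; nlinarith [abs_nonneg θ]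
  have hL0 : 0 ≤ L := (Nat.cast_nonneg K).trans hL.le
  have hterm : ∀ u : Fin n,
      jointEX q θ (fun x g => sg (x u) * (sg (est g u) * (overlap x (est g) / n))) ≤
        overlapBound n K r L q θ := by
    intro u
    have h1 := jointEX_mono hq (by linarith) hθ (overlap_term_le hL est u r)
    have h2 := abs_corr_le hL0 hq hq4 hθ u r (farOverlap K L est u r)
      (abs_farOverlap_le K L est u r) (farOverlap_congr K L est u r) (by
        intro x g h
        by_contra hs
        exact h (if_neg hs))
    have h3 := EX_SAW_le_surv_one hn (mul_nonneg hq (sq_nonneg θ)) hKS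
      (by nlinarith) (r + 1) u
    have h4 := Real.sqrt_le_sqrt h3
    have h5 : jointEX q θ (fun x g => (K / n : ℝ) + (if Good K u r g then 0 else 1) +
        1 / (L - K) ^ 2 * (∑ i, sg (x i)) ^ 2) ≤
        K / n + ((∑ i ∈ Finset.range (r + 2), (n * (2 * q)) ^ i) / K +
      (∑ t ∈ Finset.range (K + 1), (((K : ℝ) + 1) ^ 2 * (n * (2 * q))) ^ (t + 1)) / n) +
      1 / (L - K) ^ 2 * n := by
      unfold jointEX
      simp only [EX_add, EX_const (bw_sum _), EX_const unif_sum, EX_const_mul, EX_sum_sg_sq]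
      gcongr
      refine le_trans (EX_mono unif_nonneg fun x => EX_not_good_le hK hn (pe_nonneg hq hθ x)
        (fun e => (pe_le hq hθ x e).trans (by linarith)) (pe_le hq hθ x) (by linarith) u r) ?_
      rw [EX_const unif_sum]
    rw [jointEX_add] at h1
    have h6 := (le_abs_self _).trans h2
    change jointEX q θ _ ≤ _ at h6
    push_cast at h4
    unfold overlapBound
    linarith
  have hsq : ∀ (x : Fin n → Fin 2) (g : VPair n → Bool), (overlap x (est g) / n) ^ 2 =
      1 / n * ∑ u, sg (x u) * (sg (est g u) * (overlap x (est g) / n)) := by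
    intro x g
    simp only [← mul_assoc]
    rw [← Finset.sum_mul]
    change _ = 1 / n * (overlap x (est g) * _)
    ring
  simp only [hsq]
  rw [jointEX_const_mul, jointEX_sum, one_div, inv_mul_eq_div, div_le_iff₀ hn']
  refine (Finset.sum_le_sum fun u _ => hterm u).trans (le_of_eq ?_)
  simp [mul_comm]

lemma tendsto_clErr (K : ℕ) (ξ d θ : ℝ) :
    Tendsto (fun n : ℕ => clErr n K (ξ * n) (d / n) θ) atTop
      (nhds (Real.exp (|θ * d| * (K * ξ)) - 1)) := by
  have h0 : Tendsto (fun n : ℕ => d / (n : ℝ)) atTop (nhds 0) :=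
    tendsto_const_div_atTop_nhds_zero_nat d
  have h1 : Tendsto (fun n : ℕ => θ * (d / (n : ℝ)) / (1 - d / n)) atTop (nhds 0) := by
    have := (h0.const_mul θ).div (tendsto_const_nhds.sub h0 : Tendsto (fun n : ℕ => 1 - d / (n : ℝ))
      atTop (nhds (1 - 0))) (by norm_num)
    rw [mul_zero, zero_div] at this
    exact this
  have h2 : Tendsto (fun n : ℕ => θ * (d / (n : ℝ)) / (1 - d / n) * n) atTop (nhds (θ * d)) := by
    have h3 : Tendsto (fun n : ℕ => θ * d / (1 - d / (n : ℝ))) atTop (nhds (θ * d)) := by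
      have := (tendsto_const_nhds (x := θ * d)).div (tendsto_const_nhds.sub h0 :
        Tendsto (fun n : ℕ => 1 - d / (n : ℝ)) atTop (nhds (1 - 0))) (by norm_num)
      rw [sub_zero, div_one] at this
      exact this
    refine h3.congr' ?_
    filter_upwards [eventually_gt_atTop 0] with n hn
    have : (n : ℝ) ≠ 0 := by exact_mod_cast hn.ne'
    rw [div_mul_eq_mul_div, mul_assoc, div_mul_cancel₀ d this]
  have h4 := ((h2.abs.mul_const (K * ξ)).add (h1.abs.mul_const (2 * (K : ℝ) ^ 2))).add
    ((h1.mul h2).mul_const (K : ℝ))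
  simp only [abs_zero, zero_mul, add_zero] at h4
  have h5 := ((Real.continuous_exp.tendsto _).comp h4).sub_const 1
  refine h5.congr fun n => ?_
  unfold clErr
  simp only [Function.comp_apply, abs_mul (θ * (d / (n : ℝ)) / (1 - d / n)) (n : ℝ), Nat.abs_cast]
  congr 2
  ring

lemma tendsto_overlapBound (K r : ℕ) {ξ : ℝ} (hξ : 0 < ξ) (d θ : ℝ) :
    Tendsto (fun n : ℕ => overlapBound n K r (ξ * n) (d / n) θ) atTop
      (nhds (Real.exp (|θ * d| * (K * ξ)) - 1 + √(surv 1 (r + 1)) +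
        (∑ i ∈ Finset.range (r + 2), (2 * d) ^ i) / K)) := by
  have h1 : Tendsto (fun n : ℕ => √(surv 1 (r + 1) + (r + 1) / (n : ℝ))) atTop
      (nhds √(surv 1 (r + 1))) := by
    have := (tendsto_const_nhds (x := surv 1 (r + 1))).add
      (tendsto_const_div_atTop_nhds_zero_nat ((r : ℝ) + 1))
    rw [add_zero] at this
    exact (Real.continuous_sqrt.tendsto _).comp this
  have h2 := tendsto_const_div_atTop_nhds_zero_nat (K : ℝ)
  have h3 : Tendsto (fun n : ℕ => 1 / (ξ * n - K) ^ 2 * (n : ℝ)) atTop (nhds 0) := by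
    have h4 : Tendsto (fun n : ℕ => 1 / (n : ℝ) / (ξ - K / n) ^ 2) atTop (nhds (0 / (ξ - 0) ^ 2)) :=
      (tendsto_const_div_atTop_nhds_zero_nat (1 : ℝ)).div ((tendsto_const_nhds.sub h2).pow 2)
        (by rw [sub_zero]; positivity)
    rw [zero_div] at h4
    refine h4.congr' ?_
    filter_upwards [eventually_gt_atTop 0] with n hn
    have hn0 : (n : ℝ) ≠ 0 := by exact_mod_cast hn.ne'
    have : ξ * n - K = (ξ - K / n) * n := by field_simp
    rw [this, mul_pow]
    rw [div_div, one_div_mul_eq_div, sq (n : ℝ), ← mul_assoc, mul_comm (n : ℝ),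
      div_mul_cancel_right₀ hn0, one_div]
  have h5 := tendsto_const_div_atTop_nhds_zero_nat
    (∑ t ∈ Finset.range (K + 1), (((K : ℝ) + 1) ^ 2 * (2 * d)) ^ (t + 1))
  have h6 := ((tendsto_clErr K ξ d θ).add h1).add
    ((h2.add ((tendsto_const_nhds (x := (∑ i ∈ Finset.range (r + 2), (2 * d) ^ i) / (K : ℝ))).add
      h5)).add h3)
  simp only [add_zero, zero_add] at h6
  refine h6.congr' ?_
  filter_upwards [eventually_gt_atTop 0] with n hn
  have hn0 : (n : ℝ) ≠ 0 := by exact_mod_cast hn.ne'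
  have : (n : ℝ) * (2 * (d / n)) = 2 * d := by field_simp
  unfold overlapBound
  rw [this]

lemma exists_overlapBound_lt {d : ℝ} (θ : ℝ) {δ : ℝ} (hδ : 0 < δ) :
    ∃ K r : ℕ, ∃ ξ : ℝ, 0 < K ∧ 0 < ξ ∧
      ∀ᶠ n : ℕ in atTop, overlapBound n K r (ξ * n) (d / n) θ < δ := by
  have hr : Tendsto (fun r : ℕ => √(surv 1 (r + 1))) atTop (nhds 0) := by
    have := (Real.continuous_sqrt.tendsto 0).comp (tendsto_surv_one.comp (tendsto_add_atTop_nat 1))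
    rwa [Real.sqrt_zero] at this
  obtain ⟨r, hr⟩ := (hr.eventually_lt_const (show 0 < δ / 3 by positivity)).exists
  obtain ⟨K, hK, hK0⟩ := (((tendsto_const_div_atTop_nhds_zero_nat
    (∑ i ∈ Finset.range (r + 2), (2 * d) ^ i)).eventually_lt_const
      (show 0 < δ / 3 by positivity)).and (eventually_gt_atTop 0)).exists
  have hξ : Tendsto (fun ξ : ℝ => Real.exp (|θ * d| * (K * ξ)) - 1) (nhdsWithin 0 (Set.Ioi 0))
      (nhds 0) := by
    have : Continuous fun ξ : ℝ => Real.exp (|θ * d| * (K * ξ)) - 1 := by fun_prop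
    have h := this.tendsto 0
    simp only [mul_zero, Real.exp_zero, sub_self] at h
    exact h.mono_left nhdsWithin_le_nhds
  obtain ⟨ξ, hξ, hξ0⟩ := ((hξ.eventually_lt_const (show 0 < δ / 3 by positivity)).and
    self_mem_nhdsWithin).exists
  refine ⟨K, r, ξ, hK0, hξ0, (tendsto_overlapBound K r hξ0 d θ).eventually_lt_const ?_⟩
  linarith

lemma perm_fin_two (π : Equiv.Perm (Fin 2)) : (∀ i, π i = i) ∨ ∀ i, π i = 1 - i := by
  revert π
  decide

lemma sum_agree_eq {n : ℕ} (x y : Fin n → Fin 2) :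
    2 * ((Finset.univ.filter fun i => x i = y i).card : ℝ) = n + overlap x y := by
  have h : ∀ i j : Fin 2, 2 * (if i = j then (1 : ℝ) else 0) = 1 + sg i * sg j := by
    intro i j
    fin_cases i <;> fin_cases j <;> simp [sg] <;> norm_num
  rw [← Finset.sum_boole, Finset.mul_sum, Finset.sum_congr rfl fun i _ => h (x i) (y i),
    Finset.sum_add_distrib]
  simp [overlap]

lemma sq_overlap_of_agreement {n : ℕ} (hn : 0 < n) {ε : ℝ} (hε : 0 < ε) {x y : Fin n → Fin 2}
    (h : 1 / 2 + ε ≤ agreement x y) : 4 * ε ^ 2 ≤ (overlap x y / n) ^ 2 := by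
  have hn' : (0 : ℝ) < n := by exact_mod_cast hn
  obtain ⟨π, -, h⟩ := (Finset.le_sup'_iff ⟨1, Finset.mem_univ 1⟩).mp h
  rw [le_div_iff₀ hn'] at h
  have h1 := sum_agree_eq x (fun i => π (y i))
  have h2 : 2 * ε ≤ overlap x (fun i => π (y i)) / n := by
    rw [le_div_iff₀ hn']
    nlinarith
  have h3 : overlap x (fun i => π (y i)) = overlap x y ∨
      overlap x (fun i => π (y i)) = - overlap x y := by
    rcases perm_fin_two π with hπ | hπ
    · left; simp [overlap, hπ]
    · right; simp [overlap, hπ, sg_one_sub]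
  have h4 : (overlap x (fun i => π (y i)) / n) ^ 2 = (overlap x y / n) ^ 2 := by
    rcases h3 with h3 | h3 <;> rw [h3]
    ring
  rw [← h4]
  nlinarith

lemma ssbmW_eq {n : ℕ} {a b : ℝ} (ha : 0 ≤ a) (hb : 0 ≤ b) (x : Fin n → Fin 2) (e : VPair n) :
    ssbmW 2 (a / n) (b / n) (x e.1.1) (x e.1.2) =
      pe ((a + b) / 2 / n) ((a - b) / (a + b)) x e := by
  have hd : (a + b) * ((a - b) / (a + b)) = a - b := by
    rcases eq_or_ne (a + b) 0 with h | h
    · have h1 : a = 0 := by linarith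
      have h2 : b = 0 := by linarith
      simp [h1, h2]
    · field_simp
  have hs : ∀ i j : Fin 2, sg i * sg j = if i = j then 1 else -1 := by
    intro i j
    fin_cases i <;> fin_cases j <;> simp [sg]
  have h1 : pe ((a + b) / 2 / n) ((a - b) / (a + b)) x e =
      ((a + b) + (a + b) * ((a - b) / (a + b)) * spin e x) / 2 / n := by
    unfold pe; ring
  rw [h1, hd, spin, hs]
  unfold ssbmW
  simp only [Matrix.of_apply]
  split_ifs <;> ring

lemma sbmProb_eq {n : ℕ} {a b : ℝ} (ha : 0 ≤ a) (hb : 0 ≤ b)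
    (E : (Fin n → Fin 2) → (VPair n → Bool) → Prop) :
    sbmProb (fun _ : Fin 2 => (1 : ℝ) / 2) (ssbmW 2 (a / n) (b / n)) E =
      jointEX ((a + b) / 2 / n) ((a - b) / (a + b)) (fun x g => if E x g then 1 else 0) := by
  unfold sbmProb jointEX
  simp only [EX, Finset.mul_sum]
  refine Finset.sum_congr (by congr!) fun x _ => Finset.sum_congr (by congr!) fun g _ => ?_
  unfold sbmMass
  simp only [ssbmW_eq ha hb]
  split_ifs
  · simp [bw, unif]
  · simp

/-- Below the Kesten–Stigum threshold, weak recovery is not solvable in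
`SSBM(n, 2, a/n, b/n)`: if `(a−b)² ≤ 2(a+b)`, no estimator achieves agreement
`1/2 + ε` with probability tending to one. -/
theorem no_weak_recovery_below_KS (a b : ℝ) (ha : 0 ≤ a) (hb : 0 ≤ b)
    (h : (a - b) ^ 2 ≤ 2 * (a + b)) :
    ∀ ε > (0 : ℝ), ∀ est : (n : ℕ) → (VPair n → Bool) → (Fin n → Fin 2),
      ¬ Tendsto
        (fun n : ℕ =>
          sbmProb (fun _ : Fin 2 => (1 : ℝ) / 2) (ssbmW 2 (a / n) (b / n))
            fun x g => 1 / 2 + ε ≤ agreement x (est n g))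
        atTop (nhds 1) := by
  intro ε hε est hlim
  set θ := (a - b) / (a + b) with hθ
  have hθ1 : |θ| ≤ 1 := by
    rw [hθ, abs_div, abs_of_nonneg (by linarith : 0 ≤ a + b)]
    exact div_le_one_of_le₀ (abs_le.mpr ⟨by linarith, by linarith⟩) (by linarith)
  have hKS : (a + b) / 2 * θ ^ 2 ≤ 1 := by
    rcases eq_or_lt_of_le (by linarith : 0 ≤ a + b) with h0 | h0
    · rw [← h0]; norm_num
    · have : (a + b) / 2 * θ ^ 2 = (a - b) ^ 2 / (2 * (a + b)) := by
        rw [hθ]; field_simp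
      rw [this]
      exact div_le_one_of_le₀ h (by linarith)
  obtain ⟨K, r, ξ, hK, hξ, hev⟩ := exists_overlapBound_lt (d := (a + b) / 2) θ
    (show 0 < 2 * ε ^ 2 by positivity)
  have hq4 : ∀ᶠ n : ℕ in atTop, (a + b) / 2 / (n : ℝ) < 1 / 4 :=
    (tendsto_const_div_atTop_nhds_zero_nat _).eventually_lt_const (by norm_num)
  have hL : ∀ᶠ n : ℕ in atTop, (K : ℝ) < ξ * n :=
    (tendsto_natCast_atTop_atTop.const_mul_atTop hξ).eventually_gt_atTop _
  have h1 := hlim.eventually_const_lt (show (1 / 2 : ℝ) < 1 by norm_num)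
  obtain ⟨n, hn, hq4, hL, hb1, hP⟩ :=
    ((eventually_gt_atTop 0).and (hq4.and (hL.and (hev.and h1)))).exists
  have hn' : (0 : ℝ) < n := by exact_mod_cast hn
  have hq : 0 ≤ (a + b) / 2 / (n : ℝ) := by positivity
  rw [sbmProb_eq ha hb] at hP
  have h2 := jointEX_overlap_le hn hK hL hq hq4.le hθ1
    (by rw [← mul_assoc, mul_div_cancel₀ _ hn'.ne']; exact hKS) (est n) r
  have h3 : 4 * ε ^ 2 * jointEX ((a + b) / 2 / n) θ
      (fun x g => if 1 / 2 + ε ≤ agreement x (est n g) then 1 else 0) ≤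
      jointEX ((a + b) / 2 / n) θ (fun x g => (overlap x (est n g) / n) ^ 2) := by
    rw [← jointEX_const_mul]
    refine jointEX_mono hq (by linarith) hθ1 fun x g => ?_
    split_ifs with hag
    · rw [mul_one]; exact sq_overlap_of_agreement hn hε hag
    · rw [mul_zero]; positivity
  have h4 : 0 < ε ^ 2 := by positivity
  nlinarith
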